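/- arXiv:0706.4082 — 2 statements merged into one kernel-verified Lean document; each statement's English description precedes it below -/
import Mathlib

section
/- For a, b ∈ ℓ² related by a = Eb where E is the unitary operator mapping Fourier sine coefficients to Fourier cosine coefficients on [0,1], and for any ν > 0: ∑_{k=0}^∞ (ν²/(ν²+k²))|a_k|² ≤ C₁·∑_{j=1}^∞ (ν²/(ν²+j²))|b_j|² + (C₂−1)·∑_{k=1}^∞ (k²/(ν²+k²))|a_k|², where C₁ = max(9, (9/4)ν⁻²) and C₂ = 9. -/
open Real

/-- The matrix mapping Fourier sine coefficients to Fourier cosine coefficients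
on `[0,1]` (rows `k ≥ 0`, columns `j ≥ 1`; we set column `0` to zero). -/
noncomputable def Emat (k j : ℕ) : ℝ :=
  if j = 0 then 0
  else if k = 0 then (if Odd j then 2 * Real.sqrt 2 / (j * Real.pi) else 0)
  else if Odd ((j : ℤ) - (k : ℤ)) then
    4 * (j : ℝ) / (((j : ℝ) ^ 2 - (k : ℝ) ^ 2) * Real.pi)
  else 0


lemma HasSum.of_eq {ι : Type*} {f g : ι → ℝ} {a b : ℝ} (h : HasSum f a) (hfg : ∀ i, g i = f i)
    (hab : b = a) : HasSum g b := by
  rw [funext hfg, hab]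
  exact h

/-- The weight turning an even sum over `ℤ` into (half of it as) a sum over `ℕ`. -/
noncomputable def halfWeight (k : ℕ) : ℝ := if k = 0 then 1 / 2 else 1

lemma halfWeight_zero : halfWeight 0 = 1 / 2 := by simp [halfWeight]

lemma halfWeight_of_ne_zero {k : ℕ} (hk : k ≠ 0) : halfWeight k = 1 := by simp [halfWeight, hk]

lemma halfWeight_pos (k : ℕ) : 0 < halfWeight k := by
  unfold halfWeight; split_ifs <;> norm_num

lemma hasSum_halfWeight_mul {g : ℤ → ℝ} (hg : ∀ k, g (-k) = g k) {s : ℝ}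
    (h : HasSum g (2 * s)) : HasSum (fun k : ℕ => halfWeight k * g k) s := by
  have h1 := h.nat_add_neg
  have h2 : HasSum (fun k : ℕ => if k = 0 then g 0 else 0) (g 0) := by
    simpa using hasSum_ite_eq (0 : ℕ) (g 0)
  refine ((h1.sub h2).mul_left (1 / 2)).of_eq (fun k => ?_) (by ring)
  · rcases eq_or_ne k 0 with rfl | hk
    · simp [halfWeight_zero]
    · simp [halfWeight_of_ne_zero hk, hk, hg]; ring

lemma hasSum_of_hasSum_odd_shift {f : ℤ → ℝ} (hf : ∀ k, f (-k) = f k) (j : ℕ) {s : ℝ}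
    (h : HasSum (fun m : ℤ => f (j + (2 * m + 1))) (2 * s)) :
    HasSum (fun k : ℕ => if Odd (j + k) then halfWeight k * f k else 0) s := by
  have hinj : Function.Injective fun m : ℤ => (j : ℤ) + (2 * m + 1) := by
    intro a b hab
    simp only at hab
    omega
  have h1 : HasSum (fun k : ℤ => if Odd ((j : ℤ) + k) then f k else 0) (2 * s) := by
    rw [← hinj.hasSum_iff]
    · convert h using 2 with m
      have : Odd ((j : ℤ) + (j + (2 * m + 1))) := ⟨j + m, by ring⟩
      simp [this]
    · intro k hk
      rw [if_neg]
      rintro ⟨m, hm⟩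
      exact hk ⟨m - j, by simp only; omega⟩
  have h2 := hasSum_halfWeight_mul (fun k => ?_) h1
  · convert h2 using 2 with k
    have : Odd ((j : ℤ) + k) ↔ Odd (j + k) := by exact_mod_cast Iff.rfl
    simp [this]
  · have : Odd ((j : ℤ) + -k) ↔ Odd ((j : ℤ) + k) := by
      simp [Int.odd_add]
    simp [this, hf]

lemma two_mul_int_add_one_ne_zero (m : ℤ) : (2 * (m : ℝ) + 1) ≠ 0 := by
  have : (2 * m + 1) ≠ 0 := by omega
  exact_mod_cast this

lemma hasSum_odd_inv_sub_succ :
    HasSum (fun m : ℤ => 1 / (2 * (m : ℝ) + 1) - 1 / (2 * ((m : ℝ) + 1) + 1)) 0 := by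
  have h1 : HasSum (fun n : ℕ => 1 / (2 * (n : ℝ) + 1) - 1 / (2 * ((n : ℝ) + 1) + 1)) 1 := by
    rw [hasSum_iff_tendsto_nat_of_nonneg]
    · have : ∀ n : ℕ, ∑ i ∈ Finset.range n,
          (1 / (2 * (i : ℝ) + 1) - 1 / (2 * ((i : ℝ) + 1) + 1)) = 1 - 1 / (2 * (n : ℝ) + 1) := by
        intro n
        have := Finset.sum_range_sub' (fun i : ℕ => 1 / (2 * (i : ℝ) + 1)) n
        simpa using this
      simp_rw [this]
      have h0 : Filter.Tendsto (fun n : ℕ => 1 / (2 * (n : ℝ) + 1)) Filter.atTop (nhds 0) := by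
        refine Filter.Tendsto.div_atTop tendsto_const_nhds ?_
        exact Filter.tendsto_atTop_add_const_right _ _
          (tendsto_natCast_atTop_atTop.const_mul_atTop (by norm_num))
      simpa using h0.const_sub 1
    · intro n
      rw [sub_nonneg]
      gcongr
      linarith
  have h2 : HasSum (fun n : ℕ => 1 / (2 * (((-(n + 1) : ℤ)) : ℝ) + 1)
      - 1 / (2 * ((((-(n + 1) : ℤ)) : ℝ) + 1) + 1)) (-1) := by
    rw [← hasSum_nat_add_iff' 1]
    refine h1.of_eq (fun n => ?_) ?_
    · have e1 : (2 * (n : ℝ) + 1) ≠ 0 := by positivity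
      have e2 : (2 * ((n : ℝ) + 1) + 1) ≠ 0 := by positivity
      have e3 := two_mul_int_add_one_ne_zero (-(n + 1 + 1))
      have e4 := two_mul_int_add_one_ne_zero (-(n + 1))
      push_cast at *
      have e5 : 2 * (-((n : ℝ) + 1 + 1)) + 1 = -(2 * ((n : ℝ) + 1) + 1) := by ring
      have e6 : 2 * (-((n : ℝ) + 1 + 1) + 1) + 1 = -(2 * (n : ℝ) + 1) := by ring
      rw [e5, e6, div_neg, div_neg]
      ring
    · simp
      norm_num
  simpa using HasSum.of_nat_of_neg_add_one
    (f := fun m : ℤ => 1 / (2 * (m : ℝ) + 1) - 1 / (2 * ((m : ℝ) + 1) + 1)) h1 h2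

lemma hasSum_odd_inv_sub_add (d : ℕ) :
    HasSum (fun m : ℤ => 1 / (2 * (m : ℝ) + 1) - 1 / (2 * ((m : ℝ) + d) + 1)) 0 := by
  induction d with
  | zero => simp
  | succ d ih =>
    have h := (Equiv.addRight (d : ℤ)).hasSum_iff.mpr hasSum_odd_inv_sub_succ
    refine (ih.add h).of_eq (fun m => ?_) (by simp)
    simp [add_assoc]

lemma hasSum_odd_inv_sq_nat : HasSum (fun n : ℕ => 1 / (2 * (n : ℝ) + 1) ^ 2) (π ^ 2 / 8) := by
  have h := hasSum_zeta_two
  have he : HasSum (fun n : ℕ => (1 : ℝ) / ((2 * n : ℕ) : ℝ) ^ 2) (π ^ 2 / 24) := by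
    refine (h.mul_left (1 / 4)).of_eq (fun n => ?_) (by ring)
    push_cast
    rw [mul_pow, one_div_mul_one_div]
    norm_num
  have hinj : Function.Injective fun n : ℕ => 2 * n + 1 := fun a b hab => by simpa using hab
  have ho : Summable (fun n : ℕ => (1 : ℝ) / ((2 * n + 1 : ℕ) : ℝ) ^ 2) :=
    h.summable.comp_injective hinj
  have := (HasSum.even_add_odd (f := fun n : ℕ => (1 : ℝ) / (n : ℝ) ^ 2) he ho.hasSum).unique h
  have h3 := ho.hasSum
  rw [show ∑' n : ℕ, (1 : ℝ) / ((2 * n + 1 : ℕ) : ℝ) ^ 2 = π ^ 2 / 8 by linarith] at h3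
  simpa using h3

lemma hasSum_odd_inv_sq_int : HasSum (fun m : ℤ => 1 / (2 * (m : ℝ) + 1) ^ 2) (π ^ 2 / 4) := by
  have h := HasSum.of_nat_of_neg_add_one (f := fun m : ℤ => 1 / (2 * (m : ℝ) + 1) ^ 2)
    (m := π ^ 2 / 8) (m' := π ^ 2 / 8) (by simpa using hasSum_odd_inv_sq_nat) (by
      refine hasSum_odd_inv_sq_nat.of_eq (fun n => ?_) rfl
      push_cast
      congr 1
      ring)
  exact h.of_eq (fun _ => rfl) (by ring)

lemma hasSum_inv_sq_sub_sq {j : ℕ} (hj : j ≠ 0) :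
    HasSum (fun k : ℕ => if Odd (j + k) then
      halfWeight k * (1 / ((j : ℝ) ^ 2 - (k : ℝ) ^ 2)) else 0) 0 := by
  have hj' : (j : ℝ) ≠ 0 := by exact_mod_cast hj
  refine hasSum_of_hasSum_odd_shift (f := fun k : ℤ => 1 / ((j : ℝ) ^ 2 - (k : ℝ) ^ 2))
    (by simp) j ?_
  refine ((hasSum_odd_inv_sub_add j).mul_left (-1 / (2 * (j : ℝ)))).of_eq (fun m => ?_) (by simp)
  · have e1 := two_mul_int_add_one_ne_zero m
    have e2 := two_mul_int_add_one_ne_zero (m + j)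
    push_cast at *
    rw [show (j : ℝ) ^ 2 - (j + (2 * m + 1)) ^ 2 = -((2 * m + 1) * (2 * (m + j) + 1)) by ring]
    field_simp
    ring

lemma hasSum_inv_sq_sub_sq_sq {j : ℕ} (hj : j ≠ 0) :
    HasSum (fun k : ℕ => if Odd (j + k) then
      halfWeight k * (1 / ((j : ℝ) ^ 2 - (k : ℝ) ^ 2) ^ 2) else 0) (π ^ 2 / (16 * j ^ 2)) := by
  have hj' : (j : ℝ) ≠ 0 := by exact_mod_cast hj
  refine hasSum_of_hasSum_odd_shift (f := fun k : ℤ => 1 / ((j : ℝ) ^ 2 - (k : ℝ) ^ 2) ^ 2)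
    (by simp) j ?_
  have hs := (Equiv.addRight (j : ℤ)).hasSum_iff.mpr hasSum_odd_inv_sq_int
  refine (((hasSum_odd_inv_sq_int.add hs).sub
    ((hasSum_odd_inv_sub_add j).mul_left (1 / (j : ℝ)))).mul_left
      (1 / (4 * (j : ℝ) ^ 2))).of_eq (fun m => ?_) ?_
  · have e1 := two_mul_int_add_one_ne_zero m
    have e2 := two_mul_int_add_one_ne_zero (m + j)
    simp only [Function.comp, Equiv.coe_addRight]
    push_cast at *
    rw [show (j : ℝ) ^ 2 - (j + (2 * m + 1)) ^ 2 = -((2 * m + 1) * (2 * (m + j) + 1)) by ring]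
    field_simp
    ring
  · field_simp
    ring

lemma hasSum_halfWeight_inv_sq_add_sq {ν : ℝ} (hν : 0 < ν) :
    HasSum (fun k : ℕ => halfWeight k * (1 / (ν ^ 2 + (k : ℝ) ^ 2)))
      (π / (2 * ν) * (cosh (π * ν) / sinh (π * ν))) := by
  have hx : (ν : ℂ) * Complex.I ∈ Complex.integerComplement := by
    rintro ⟨n, hn⟩
    have := congrArg Complex.im hn
    simp at this
    exact hν.ne this
  have hs := (summable_cotTerm hx).hasSum
  have hsinh : sinh (π * ν) ≠ 0 := (sinh_pos_iff.mpr (by positivity)).ne'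
  have hcot : (π : ℂ) * Complex.cot (π * (ν * Complex.I)) - 1 / (ν * Complex.I)
      = ((1 / ν - π * (cosh (π * ν) / sinh (π * ν)) : ℝ) : ℂ) * Complex.I := by
    have hsinh' : Complex.sinh (π * ν) ≠ 0 := by exact_mod_cast hsinh
    have hν' : (ν : ℂ) ≠ 0 := by exact_mod_cast hν.ne'
    rw [← mul_assoc, Complex.cot, Complex.cos_mul_I, Complex.sin_mul_I]
    push_cast
    field_simp
    rw [Complex.I_sq]
    ring
  have hterm : ∀ n : ℕ, cotTerm ((ν : ℂ) * Complex.I) n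
      = ((-(2 * ν) * (1 / (ν ^ 2 + ((n + 1 : ℕ) : ℝ) ^ 2)) : ℝ) : ℂ) * Complex.I := by
    intro n
    have h0 : ((ν ^ 2 + ((n + 1 : ℕ) : ℝ) ^ 2 : ℝ) : ℂ) ≠ 0 := by
      exact_mod_cast (by positivity : (ν ^ 2 + ((n + 1 : ℕ) : ℝ) ^ 2 : ℝ) ≠ 0)
    push_cast at *
    have h1 : ((ν : ℂ) * Complex.I - (n + 1)) * (ν * Complex.I + (n + 1))
        = -(ν ^ 2 + (n + 1) ^ 2) := by
      linear_combination (ν : ℂ) ^ 2 * Complex.I_sq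
    have h2 : ((ν : ℂ) * Complex.I - (n + 1)) ≠ 0 := by
      intro h; rw [h, zero_mul] at h1; exact h0 (neg_eq_zero.mp h1.symm)
    have h3 : ((ν : ℂ) * Complex.I + (n + 1)) ≠ 0 := by
      intro h; rw [h, mul_zero] at h1; exact h0 (neg_eq_zero.mp h1.symm)
    rw [cotTerm, one_div_add_one_div h2 h3, h1]
    field_simp
    ring
  rw [← show _ = _ from cot_series_rep' hx] at hs
  rw [hcot] at hs
  have him := Complex.hasSum_im hs
  rw [← hasSum_nat_add_iff' 1]
  refine (him.mul_left (-1 / (2 * ν))).of_eq (fun n => ?_) ?_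
  · rw [hterm n, Complex.im_ofReal_mul, Complex.I_im, mul_one, halfWeight_of_ne_zero n.succ_ne_zero]
    field_simp
  · rw [Complex.im_ofReal_mul, Complex.I_im, mul_one, Finset.sum_range_one, halfWeight_zero]
    push_cast
    field_simp
    ring

/-- Half of the sum of `1 / (ν ^ 2 + k ^ 2)` over all integers `k` with `p + k` odd. -/
noncomputable def resolventSum (ν : ℝ) (p : ℕ) : ℝ :=
  ∑' k : ℕ, if Odd (p + k) then halfWeight k * (1 / (ν ^ 2 + (k : ℝ) ^ 2)) else 0

lemma hasSum_resolventSum {ν : ℝ} (hν : 0 < ν) (p : ℕ) :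
    HasSum (fun k : ℕ => if Odd (p + k) then halfWeight k * (1 / (ν ^ 2 + (k : ℝ) ^ 2)) else 0)
      (resolventSum ν p) := by
  refine (Summable.of_nonneg_of_le (fun k => ?_) (fun k => ?_)
    (hasSum_halfWeight_inv_sq_add_sq hν).summable).hasSum
  · have := halfWeight_pos k
    split_ifs <;> positivity
  · have := halfWeight_pos k
    split_ifs
    · exact le_rfl
    · positivity

lemma resolventSum_nonneg {ν : ℝ} (hν : 0 < ν) (p : ℕ) : 0 ≤ resolventSum ν p :=
  (hasSum_resolventSum hν p).nonneg fun k => by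
    have := halfWeight_pos k
    split_ifs <;> positivity

lemma resolventSum_congr {ν : ℝ} {p q : ℕ} (h : Even (p + q)) :
    resolventSum ν p = resolventSum ν q := by
  unfold resolventSum
  congr! 3 with k
  grind

lemma hasSum_resolventSum_one {ν : ℝ} (hν : 0 < ν) :
    HasSum (fun m : ℕ => halfWeight m * (1 / (ν ^ 2 + (2 * (m : ℝ)) ^ 2))) (resolventSum ν 1) := by
  have hinj : Function.Injective fun m : ℕ => 2 * m := fun a b hab => by simpa using hab
  have h := hasSum_resolventSum hν 1
  rw [← hinj.hasSum_iff] at h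
  · refine h.of_eq (fun m => ?_) rfl
    have h1 : Odd (1 + 2 * m) := ⟨m, by ring⟩
    have h2 : halfWeight (2 * m) = halfWeight m := by simp [halfWeight]
    simp [h1, h2]
  · intro k hk
    rw [if_neg]
    rintro ⟨m, hm⟩
    exact hk ⟨m, by simp only; omega⟩

lemma resolventSum_one_eq {ν : ℝ} (hν : 0 < ν) :
    resolventSum ν 1 = π / (4 * ν) * (cosh (π * ν / 2) / sinh (π * ν / 2)) := by
  refine (hasSum_resolventSum_one hν).unique ?_
  have h := (hasSum_halfWeight_inv_sq_add_sq (half_pos hν)).mul_left (1 / 4)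
  refine h.of_eq (fun m => ?_) ?_
  · field_simp
    ring
  · rw [mul_div_assoc]
    field_simp

lemma resolventSum_zero_add_one {ν : ℝ} (hν : 0 < ν) :
    resolventSum ν 0 + resolventSum ν 1 = π / (2 * ν) * (cosh (π * ν) / sinh (π * ν)) := by
  refine ((hasSum_resolventSum hν 0).add (hasSum_resolventSum hν 1)).unique
    ((hasSum_halfWeight_inv_sq_add_sq hν).of_eq (fun k => ?_) rfl)
  rcases Nat.even_or_odd k with hk | hk <;> simp [Nat.odd_add, hk]

lemma resolventSum_zero_mul_one {ν : ℝ} (hν : 0 < ν) :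
    resolventSum ν 0 * resolventSum ν 1 = π ^ 2 / (16 * ν ^ 2) := by
  have h1 := resolventSum_one_eq hν
  have h2 := resolventSum_zero_add_one hν
  have hs : 0 < sinh (π * ν / 2) := sinh_pos_iff.mpr (by positivity)
  have hc := cosh_pos (π * ν / 2)
  rw [show π * ν = 2 * (π * ν / 2) by ring, cosh_two_mul, sinh_two_mul] at h2
  rw [show resolventSum ν 0 = π / (4 * ν) * (sinh (π * ν / 2) / cosh (π * ν / 2)) by
    rw [eq_sub_of_add_eq h2, h1]
    field_simp
    ring, h1]
  field_simp
  ring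

lemma resolventSum_one_le {ν : ℝ} (hν : 0 < ν) :
    resolventSum ν 1 ≤ 1 / (2 * ν ^ 2) + π ^ 2 / 24 := by
  have h := hasSum_resolventSum_one hν
  have h2 : HasSum (fun m : ℕ => (if m = 0 then 1 / (2 * ν ^ 2) else 0)
      + 1 / 4 * (1 / (m : ℝ) ^ 2)) (1 / (2 * ν ^ 2) + 1 / 4 * (π ^ 2 / 6)) :=
    (hasSum_ite_eq (0 : ℕ) (1 / (2 * ν ^ 2))).add (hasSum_zeta_two.mul_left (1 / 4))
  refine (hasSum_le (fun m => ?_) h h2).trans_eq (by ring)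
  rcases eq_or_ne m 0 with rfl | hm
  · simp [halfWeight_zero]
    exact le_of_eq (by ring)
  · have : (0 : ℝ) < m := by exact_mod_cast Nat.pos_of_ne_zero hm
    rw [halfWeight_of_ne_zero hm, if_neg hm, one_mul, zero_add, one_div_mul_one_div]
    gcongr
    nlinarith [sq_nonneg ν]

lemma Emat_zero_right (k : ℕ) : Emat k 0 = 0 := by simp [Emat]

lemma odd_intCast_sub_iff (j k : ℕ) : Odd ((j : ℤ) - k) ↔ Odd (j + k) := by
  rw [Int.odd_sub, ← Int.odd_add]
  exact_mod_cast Iff.rfl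

lemma Emat_eq_zero {k j : ℕ} (h : ¬ Odd (j + k)) : Emat k j = 0 := by
  unfold Emat
  split_ifs with h1 h2 h3 h4
  · rfl
  · subst h2
    exact absurd h3 h
  · rfl
  · exact absurd ((odd_intCast_sub_iff j k).mp h4) h
  · rfl

lemma sq_sub_sq_ne_zero {j k : ℕ} (h : Odd (j + k)) : (j : ℝ) ^ 2 - (k : ℝ) ^ 2 ≠ 0 := by
  intro h0
  have h1 : (j : ℝ) = k := (sq_eq_sq₀ (by positivity) (by positivity)).mp (sub_eq_zero.mp h0)
  have h2 : j = k := by exact_mod_cast h1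
  subst h2
  rcases h with ⟨m, hm⟩
  omega

lemma Emat_mul_Emat {k j j' : ℕ} (h : Odd (j + k)) (h' : Odd (j' + k)) :
    Emat k j * Emat k j' = 16 * j * j' / π ^ 2 *
      (halfWeight k * (1 / (((j : ℝ) ^ 2 - (k : ℝ) ^ 2) * ((j' : ℝ) ^ 2 - (k : ℝ) ^ 2)))) := by
  rcases eq_or_ne j 0 with rfl | hj
  · simp [Emat_zero_right]
  rcases eq_or_ne j' 0 with rfl | hj'
  · simp [Emat_zero_right]
  have a1 : (j : ℝ) ≠ 0 := by exact_mod_cast hj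
  have a2 : (j' : ℝ) ≠ 0 := by exact_mod_cast hj'
  have e1 := sq_sub_sq_ne_zero h
  have e2 := sq_sub_sq_ne_zero h'
  rcases eq_or_ne k 0 with rfl | hk
  · rw [add_zero] at h h'
    simp only [Emat, hj, hj', h, h', halfWeight_zero, if_true, if_false]
    push_cast
    field_simp
    rw [Real.sq_sqrt (by norm_num)]
    ring
  · simp only [Emat, hj, hj', hk, odd_intCast_sub_iff, h, h', halfWeight_of_ne_zero hk, if_true,
      if_false]
    field_simp
    ring

/-- The columns of `Emat` are orthonormal. -/
lemma hasSum_Emat_mul_Emat {j j' : ℕ} (hj : j ≠ 0) (hj' : j' ≠ 0) :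
    HasSum (fun k => Emat k j * Emat k j') (if j = j' then 1 else 0) := by
  have a1 : (j : ℝ) ≠ 0 := by exact_mod_cast hj
  split_ifs with hjj
  · subst hjj
    refine ((hasSum_inv_sq_sub_sq_sq hj).mul_left (16 * j * j / π ^ 2)).of_eq (fun k => ?_) ?_
    · split_ifs with h
      · rw [Emat_mul_Emat h h, sq ((j : ℝ) ^ 2 - (k : ℝ) ^ 2)]
      · rw [Emat_eq_zero h]
        ring
    · field_simp
  · have hne : (j' : ℝ) ^ 2 - (j : ℝ) ^ 2 ≠ 0 := by
      intro h0
      have h1 : (j' : ℝ) = j := (sq_eq_sq₀ (by positivity) (by positivity)).mp (sub_eq_zero.mp h0)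
      exact hjj (by exact_mod_cast h1.symm)
    by_cases hp : Even (j + j')
    · refine (((hasSum_inv_sq_sub_sq hj).sub (hasSum_inv_sq_sub_sq hj')).mul_left
        (16 * j * j' / π ^ 2 / ((j' : ℝ) ^ 2 - (j : ℝ) ^ 2))).of_eq (fun k => ?_) (by simp)
      by_cases h : Odd (j + k)
      · have h' : Odd (j' + k) := by grind
        rw [Emat_mul_Emat h h', if_pos h, if_pos h']
        have e1 := sq_sub_sq_ne_zero h
        have e2 := sq_sub_sq_ne_zero h'
        field_simp
        ring
      · have h' : ¬ Odd (j' + k) := by grind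
        simp [Emat_eq_zero h, h, h']
    · refine hasSum_zero.of_eq (fun k => ?_) rfl
      by_cases h : Odd (j + k)
      · have h' : ¬ Odd (j' + k) := by grind
        rw [Emat_eq_zero h', mul_zero]
      · rw [Emat_eq_zero h, zero_mul]

/-- The sine coefficients (up to a constant) of the hyperbolic function solving
`-u'' + (π ν) ^ 2 u = 0` of given parity. -/
noncomputable def boundaryCoeff (ν : ℝ) (j : ℕ) : ℝ := j / (ν ^ 2 + (j : ℝ) ^ 2)

lemma hasSum_weighted_Emat_mul_Emat {ν : ℝ} (hν : 0 < ν) {j j' : ℕ} (hj : j ≠ 0) (hj' : j' ≠ 0) :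
    HasSum (fun k : ℕ => ν ^ 2 / (ν ^ 2 + (k : ℝ) ^ 2) * (Emat k j * Emat k j'))
      ((if j = j' then ν ^ 2 / (ν ^ 2 + (j : ℝ) ^ 2) else 0)
        + if Even (j + j') then 16 * ν ^ 2 / π ^ 2 * resolventSum ν j *
          (boundaryCoeff ν j * boundaryCoeff ν j') else 0) := by
  have b1 : ν ^ 2 + (j : ℝ) ^ 2 ≠ 0 := by positivity
  have b2 : ν ^ 2 + (j' : ℝ) ^ 2 ≠ 0 := by positivity
  by_cases hp : Even (j + j')
  · have h1 := (hasSum_Emat_mul_Emat hj hj').mul_left (ν ^ 2 / (ν ^ 2 + (j : ℝ) ^ 2))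
    have h2 := ((hasSum_inv_sq_sub_sq hj').add (hasSum_resolventSum hν j)).mul_left
      (16 * ν ^ 2 / π ^ 2 * (boundaryCoeff ν j * boundaryCoeff ν j'))
    refine (h1.add h2).of_eq (fun k => ?_) ?_
    · by_cases h : Odd (j + k)
      · have h' : Odd (j' + k) := by grind
        rw [Emat_mul_Emat h h', if_pos h, if_pos h']
        have e1 := sq_sub_sq_ne_zero h
        have e2 := sq_sub_sq_ne_zero h'
        have e3 : ν ^ 2 + (k : ℝ) ^ 2 ≠ 0 := by positivity
        unfold boundaryCoeff
        field_simp
        ring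
      · have h' : ¬ Odd (j' + k) := by grind
        simp [Emat_eq_zero h, h, h']
    · rw [if_pos hp]
      split_ifs <;> ring
  · have hne : j ≠ j' := by
      rintro rfl
      exact hp ⟨j, rfl⟩
    rw [if_neg hne, if_neg hp, add_zero]
    refine hasSum_zero.of_eq (fun k => ?_) rfl
    by_cases h : Odd (j + k)
    · have h' : ¬ Odd (j' + k) := by grind
      rw [Emat_eq_zero h']
      ring
    · rw [Emat_eq_zero h]
      ring

lemma sum_parity_telescope (h : ℝ → ℝ) (h0 : h 0 = 0) (hodd : ∀ x, h (-x) = -h x) (p n : ℕ) :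
    ∑ k ∈ Finset.range (n + 1),
      (if Odd (p + k) then halfWeight k * (h (k + 1) - h (k - 1)) else 0)
      = if Odd (p + (n + 1)) then h n else h (n + 1) := by
  induction n with
  | zero =>
    have h1 := hodd 1
    by_cases hp : Odd p
    · have : ¬ Odd (p + 1) := by grind
      simp [hp, this, halfWeight_zero, h1]
      ring
    · have : Odd (p + 1) := by grind
      simp [hp, this, h0]
  | succ n ih =>
    rw [Finset.sum_range_succ, ih]
    by_cases hp : Odd (p + (n + 1))
    · have : ¬ Odd (p + (n + 1 + 1)) := by grind
      simp [hp, this, halfWeight_of_ne_zero]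
    · have : Odd (p + (n + 1 + 1)) := by grind
      simp [hp, this]

lemma poly_nonneg_of_four_le {y t : ℝ} (hy : 0 ≤ y) (ht : 4 ≤ t) :
    0 ≤ (y + t) ^ 2 * (6 * y + t - 2) + (8 * y - t) * (2 * y - 2 * t + 1) := by
  obtain ⟨r, hr, rfl⟩ : ∃ r, 0 ≤ r ∧ t = 4 + r := ⟨t - 4, by linarith, by ring⟩
  ring_nf
  nlinarith [mul_nonneg hy hr, mul_nonneg (mul_nonneg hy hr) hr, mul_nonneg (mul_nonneg hy hy) hr,
    mul_nonneg (mul_nonneg hr hr) hr, mul_nonneg hr hr, mul_nonneg hy hy,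
    mul_nonneg (mul_nonneg hy hy) hy]

lemma poly_nonneg_of_one {y : ℝ} (hy : 1 / 4 ≤ y) :
    0 ≤ (y + 1) ^ 2 * (6 * y + 1 - 2) + (8 * y - 1) * (2 * y - 2 * 1 + 1) := by
  obtain ⟨r, hr, rfl⟩ : ∃ r, 0 ≤ r ∧ y = 1 / 4 + r := ⟨y - 1 / 4, by linarith, by ring⟩
  ring_nf
  nlinarith [mul_nonneg hr hr, mul_nonneg (mul_nonneg hr hr) hr]

lemma nine_mul_boundaryCoeff_sq_le {ν : ℝ} (hν : 0 < ν) {k : ℕ} (hk : k = 1 → 1 / 2 ≤ ν) :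
    9 * boundaryCoeff ν k ^ 2 ≤ 8 * (halfWeight k * (1 / (ν ^ 2 + (k : ℝ) ^ 2)))
      - halfWeight k * (((k : ℝ) + 1) / (ν ^ 2 + ((k : ℝ) + 1) ^ 2)
        - ((k : ℝ) - 1) / (ν ^ 2 + ((k : ℝ) - 1) ^ 2)) := by
  rcases eq_or_ne k 0 with rfl | hk0
  · have : 1 / (ν ^ 2 + 1) ≤ 1 / ν ^ 2 := by
      gcongr
      linarith
    have h2 : 0 < ν⁻¹ ^ 2 := by positivity
    simp only [boundaryCoeff, halfWeight_zero]
    norm_num at this ⊢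
    ring_nf at this ⊢
    linarith
  · have hpoly : 0 ≤ (ν ^ 2 + (k : ℝ) ^ 2) ^ 2 * (6 * ν ^ 2 + (k : ℝ) ^ 2 - 2)
        + (8 * ν ^ 2 - (k : ℝ) ^ 2) * (2 * ν ^ 2 - 2 * (k : ℝ) ^ 2 + 1) := by
      rcases eq_or_ne k 1 with rfl | hk1
      · have := poly_nonneg_of_one (y := ν ^ 2) (by nlinarith [hk rfl])
        simpa using this
      · have h2 : (2 : ℝ) ≤ k := by exact_mod_cast (by omega : 2 ≤ k)
        exact poly_nonneg_of_four_le (by positivity) (by nlinarith)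
    have b0 : 0 < ν ^ 2 + (k : ℝ) ^ 2 := by positivity
    have b1 : 0 < ν ^ 2 + ((k : ℝ) + 1) ^ 2 := by positivity
    have b2 : 0 < ν ^ 2 + ((k : ℝ) - 1) ^ 2 := by positivity
    rw [halfWeight_of_ne_zero hk0, boundaryCoeff, ← sub_nonneg]
    have key : 8 * (1 * (1 / (ν ^ 2 + (k : ℝ) ^ 2)))
        - 1 * (((k : ℝ) + 1) / (ν ^ 2 + ((k : ℝ) + 1) ^ 2)
        - ((k : ℝ) - 1) / (ν ^ 2 + ((k : ℝ) - 1) ^ 2)) - 9 * ((k : ℝ) / (ν ^ 2 + (k : ℝ) ^ 2)) ^ 2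
        = ((ν ^ 2 + (k : ℝ) ^ 2) ^ 2 * (6 * ν ^ 2 + (k : ℝ) ^ 2 - 2)
        + (8 * ν ^ 2 - (k : ℝ) ^ 2) * (2 * ν ^ 2 - 2 * (k : ℝ) ^ 2 + 1))
        / ((ν ^ 2 + (k : ℝ) ^ 2) ^ 2 * ((ν ^ 2 + ((k : ℝ) + 1) ^ 2)
          * (ν ^ 2 + ((k : ℝ) - 1) ^ 2))) := by
      field_simp
      ring
    rw [key]
    positivity

/-- The restriction of `boundaryCoeff` to the indices `j` with `p + j` odd. -/
noncomputable def parityCoeff (ν : ℝ) (p j : ℕ) : ℝ :=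
  if Odd (p + j) then boundaryCoeff ν j else 0

lemma sum_parityCoeff_sq_le {ν : ℝ} (hν : 0 < ν) {p : ℕ} (hp : Even p → 1 / 2 ≤ ν)
    (s : Finset ℕ) :
    9 * ∑ j ∈ s, parityCoeff ν p j ^ 2 ≤ 8 * resolventSum ν p := by
  obtain ⟨n, hn⟩ := s.exists_nat_subset_range
  have hsub : s ⊆ Finset.range (n + 1) := hn.trans (Finset.range_subset_range.mpr n.le_succ)
  have h1 : ∑ j ∈ s, parityCoeff ν p j ^ 2 ≤ ∑ j ∈ Finset.range (n + 1), parityCoeff ν p j ^ 2 :=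
    Finset.sum_le_sum_of_subset_of_nonneg hsub fun _ _ _ => sq_nonneg _
  have h2 := (hasSum_resolventSum hν p).summable.sum_le_tsum (Finset.range (n + 1)) (fun k _ => by
    have := halfWeight_pos k
    split_ifs <;> positivity)
  have h3 := sum_parity_telescope (fun x => x / (ν ^ 2 + x ^ 2)) (by simp)
    (fun x => by ring) p n
  have h4 : ∑ j ∈ Finset.range (n + 1), 9 * parityCoeff ν p j ^ 2
      ≤ ∑ k ∈ Finset.range (n + 1),
        (8 * (if Odd (p + k) then halfWeight k * (1 / (ν ^ 2 + (k : ℝ) ^ 2)) else 0)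
        - (if Odd (p + k) then halfWeight k * (((k : ℝ) + 1) / (ν ^ 2 + ((k : ℝ) + 1) ^ 2)
        - ((k : ℝ) - 1) / (ν ^ 2 + ((k : ℝ) - 1) ^ 2)) else 0)) := by
    refine Finset.sum_le_sum fun k _ => ?_
    unfold parityCoeff
    split_ifs with h
    · refine nine_mul_boundaryCoeff_sq_le hν ?_
      rintro rfl
      exact hp (by grind)
    · simp
  rw [← Finset.mul_sum, Finset.sum_sub_distrib, ← Finset.mul_sum, h3] at h4
  have h5 : 0 ≤ if Odd (p + (n + 1)) then (n : ℝ) / (ν ^ 2 + (n : ℝ) ^ 2)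
      else ((n : ℝ) + 1) / (ν ^ 2 + ((n : ℝ) + 1) ^ 2) := by
    split_ifs <;> positivity
  change _ ≤ resolventSum ν p at h2
  linarith

/-- The coefficients of the quadratic form that controls the boundary terms. -/
noncomputable def formCoeff (ν : ℝ) (j : ℕ) : ℝ :=
  8 + (max 9 ((9 / 4) / ν ^ 2) - 9) * (ν ^ 2 / (ν ^ 2 + (j : ℝ) ^ 2))

lemma eight_le_formCoeff {ν : ℝ} (hν : 0 < ν) (j : ℕ) : 8 ≤ formCoeff ν j := by
  have h1 : 0 ≤ max 9 ((9 / 4) / ν ^ 2) - 9 := sub_nonneg.mpr (le_max_left _ _)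
  have : 0 ≤ (max 9 ((9 / 4) / ν ^ 2) - 9) * (ν ^ 2 / (ν ^ 2 + (j : ℝ) ^ 2)) := by positivity
  unfold formCoeff
  linarith

lemma formCoeff_eq {ν : ℝ} (hν : 0 < ν) (hν2 : ν ≤ 1 / 2) (j : ℕ) :
    formCoeff ν j = (8 * (j : ℝ) ^ 2 + 9 / 4 - ν ^ 2) / (ν ^ 2 + (j : ℝ) ^ 2) := by
  have h : 9 ≤ (9 / 4) / ν ^ 2 := by
    rw [le_div_iff₀ (by positivity)]
    nlinarith
  rw [formCoeff, max_eq_right h]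
  field_simp
  ring

lemma boundaryCoeff_sq_div_formCoeff_le {ν : ℝ} (hν : 0 < ν) (hν2 : ν ≤ 1 / 2) {j : ℕ}
    (hj : 2 ≤ j) :
    boundaryCoeff ν j ^ 2 / formCoeff ν j
      ≤ 1 / 16 * (1 / ((j : ℝ) - 1) - 1 / ((j : ℝ) + 1)) := by
  have hj' : (2 : ℝ) ≤ j := by exact_mod_cast hj
  have hy : ν ^ 2 ≤ 1 / 4 := by nlinarith
  have b1 : 0 < 8 * (j : ℝ) ^ 2 + 9 / 4 - ν ^ 2 := by nlinarith
  have b2 : 0 < (j : ℝ) - 1 := by linarith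
  have b3 : (0 : ℝ) < 8 * (((j : ℝ) - 1) * (j + 1)) := by positivity
  calc boundaryCoeff ν j ^ 2 / formCoeff ν j
      = (j : ℝ) ^ 2 / (ν ^ 2 + (j : ℝ) ^ 2) * (1 / (8 * (j : ℝ) ^ 2 + 9 / 4 - ν ^ 2)) := by
        rw [formCoeff_eq hν hν2, boundaryCoeff]
        field_simp
    _ ≤ 1 * (1 / (8 * (((j : ℝ) - 1) * (j + 1)))) := by
        gcongr
        · exact div_le_one_of_le₀ (by nlinarith [sq_nonneg ν]) (by positivity)
        · nlinarith
    _ = 1 / 16 * (1 / ((j : ℝ) - 1) - 1 / ((j : ℝ) + 1)) := by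
        field_simp
        ring

lemma sum_range_parityCoeff_sq_div_formCoeff_le {ν : ℝ} (hν : 0 < ν) (hν2 : ν ≤ 1 / 2) (n : ℕ) :
    ∑ j ∈ Finset.range (n + 2), parityCoeff ν 0 j ^ 2 / formCoeff ν j
      ≤ 1 / ((1 + ν ^ 2) * (41 / 4 - ν ^ 2)) + 1 / 32
        - 1 / 16 * (if Odd n then 1 / ((n : ℝ) + 1) else 1 / ((n : ℝ) + 2)) := by
  have hy : ν ^ 2 ≤ 1 / 4 := by nlinarith
  have b1 : 0 < 41 / 4 - ν ^ 2 := by linarith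
  induction n with
  | zero =>
    refine le_of_eq ?_
    have b2 : (8 + 9 / 4 - ν ^ 2) ≠ 0 := by linarith
    simp [Finset.sum_range_succ, parityCoeff, boundaryCoeff, formCoeff_eq hν hν2]
    norm_num
    field_simp
    ring
  | succ n ih =>
    rw [show n + 1 + 2 = n + 2 + 1 by ring, Finset.sum_range_succ]
    have h := boundaryCoeff_sq_div_formCoeff_le hν hν2 (j := n + 2) (by omega)
    by_cases hn : Odd n
    · have h1 : ¬ Odd (n + 1) := by grind
      have h2 : Odd (0 + (n + 2)) := by grind
      rw [if_pos hn] at ih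
      rw [if_neg h1, parityCoeff, if_pos h2]
      push_cast at *
      rw [show (n : ℝ) + 2 - 1 = n + 1 by ring] at h
      rw [show (n : ℝ) + 1 + 2 = n + 2 + 1 by ring]
      linarith
    · have h1 : Odd (n + 1) := by grind
      have h2 : ¬ Odd (0 + (n + 2)) := by grind
      rw [if_neg hn] at ih
      rw [if_pos h1, parityCoeff, if_neg h2]
      push_cast at *
      rw [show (n : ℝ) + 1 + 1 = n + 2 by ring]
      simpa using ih

lemma sum_parityCoeff_sq_div_formCoeff_le_of_le {ν : ℝ} (hν : 0 < ν) (hν2 : ν ≤ 1 / 2)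
    (s : Finset ℕ) :
    ∑ j ∈ s, parityCoeff ν 0 j ^ 2 / formCoeff ν j
      ≤ 1 / ((1 + ν ^ 2) * (41 / 4 - ν ^ 2)) + 1 / 32 := by
  obtain ⟨n, hn⟩ := s.exists_nat_subset_range
  have hsub : s ⊆ Finset.range (n + 2) :=
    hn.trans (Finset.range_subset_range.mpr (Nat.le_add_right n 2))
  refine (Finset.sum_le_sum_of_subset_of_nonneg hsub fun j _ _ => ?_).trans
    ((sum_range_parityCoeff_sq_div_formCoeff_le hν hν2 n).trans ?_)
  · have := eight_le_formCoeff hν j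
    positivity
  · have : 0 ≤ if Odd n then 1 / ((n : ℝ) + 1) else 1 / ((n : ℝ) + 2) := by
      split_ifs <;> positivity
    linarith

lemma boundary_constant_le_one {ν : ℝ} (hν : 0 < ν) (hν2 : ν ≤ 1 / 2) :
    9 * (16 * ν ^ 2 / π ^ 2 * resolventSum ν 1)
      * (1 / ((1 + ν ^ 2) * (41 / 4 - ν ^ 2)) + 1 / 32) ≤ 1 := by
  have hy : ν ^ 2 ≤ 1 / 4 := by nlinarith
  have b1 : 0 < 41 / 4 - ν ^ 2 := by linarith
  have hpi : (3.14 : ℝ) ^ 2 ≤ π ^ 2 := by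
    have := Real.pi_gt_d2
    gcongr
  have hk : 16 * ν ^ 2 / π ^ 2 * resolventSum ν 1 ≤ 8 / 3.14 ^ 2 + 2 / 3 * ν ^ 2 := by
    calc _ ≤ 16 * ν ^ 2 / π ^ 2 * (1 / (2 * ν ^ 2) + π ^ 2 / 24) := by
          gcongr
          exact resolventSum_one_le hν
      _ = 8 / π ^ 2 + 2 / 3 * ν ^ 2 := by
          field_simp
          ring
      _ ≤ _ := by gcongr
  calc _ ≤ 9 * (8 / 3.14 ^ 2 + 2 / 3 * ν ^ 2)
        * (1 / ((1 + ν ^ 2) * (41 / 4 - ν ^ 2)) + 1 / 32) := by gcongr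
    _ ≤ 1 := by
      have hy0 : 0 ≤ ν ^ 2 := sq_nonneg ν
      generalize ν ^ 2 = y at *
      rw [div_add_div _ _ (by positivity) (by norm_num), ← mul_div_assoc,
        div_le_one (by positivity)]
      norm_num
      nlinarith [mul_nonneg hy0 (sub_nonneg.mpr hy), mul_nonneg hy0 hy0,
        mul_nonneg (mul_nonneg hy0 hy0) (sub_nonneg.mpr hy)]

lemma sum_parityCoeff_sq_div_formCoeff_le {ν : ℝ} (hν : 0 < ν) {p : ℕ} (hp : Even p → 1 / 2 ≤ ν)
    (s : Finset ℕ) :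
    ∑ j ∈ s, parityCoeff ν p j ^ 2 / formCoeff ν j ≤ resolventSum ν p / 9 := by
  have h := sum_parityCoeff_sq_le hν hp s
  calc _ ≤ ∑ j ∈ s, parityCoeff ν p j ^ 2 / 8 := by
        gcongr with j
        exact eight_le_formCoeff hν j
    _ ≤ _ := by
        rw [← Finset.sum_div]
        linarith

lemma boundary_sum_zero_le {ν : ℝ} (hν : 0 < ν) (s : Finset ℕ) :
    9 * (16 * ν ^ 2 / π ^ 2 * resolventSum ν 1)
      * ∑ j ∈ s, parityCoeff ν 0 j ^ 2 / formCoeff ν j ≤ 1 := by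
  have hR := resolventSum_nonneg hν 1
  rcases le_total ν (1 / 2) with hν2 | hν2
  · refine le_trans ?_ (boundary_constant_le_one hν hν2)
    gcongr
    exact sum_parityCoeff_sq_div_formCoeff_le_of_le hν hν2 s
  · calc _ ≤ 9 * (16 * ν ^ 2 / π ^ 2 * resolventSum ν 1) * (resolventSum ν 0 / 9) := by
          gcongr
          exact sum_parityCoeff_sq_div_formCoeff_le hν (fun _ => hν2) s
      _ = 16 * ν ^ 2 / π ^ 2 * (resolventSum ν 0 * resolventSum ν 1) := by ring
      _ = 1 := by
          rw [resolventSum_zero_mul_one hν]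
          field_simp
      _ ≤ 1 := le_rfl

lemma boundary_sum_one_le {ν : ℝ} (hν : 0 < ν) (s : Finset ℕ) :
    9 * (16 * ν ^ 2 / π ^ 2 * resolventSum ν 0)
      * ∑ j ∈ s, parityCoeff ν 1 j ^ 2 / formCoeff ν j ≤ 1 := by
  have hR := resolventSum_nonneg hν 0
  calc _ ≤ 9 * (16 * ν ^ 2 / π ^ 2 * resolventSum ν 0) * (resolventSum ν 1 / 9) := by
        gcongr
        exact sum_parityCoeff_sq_div_formCoeff_le hν (by simp) s
    _ = 16 * ν ^ 2 / π ^ 2 * (resolventSum ν 0 * resolventSum ν 1) := by ring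
    _ = 1 := by
        rw [resolventSum_zero_mul_one hν]
        field_simp
    _ ≤ 1 := le_rfl

lemma even_add_mul_eq_parityCoeff (ν : ℝ) (j j' : ℕ) :
    (if Even (j + j') then 16 * ν ^ 2 / π ^ 2 * resolventSum ν j *
      (boundaryCoeff ν j * boundaryCoeff ν j') else 0)
      = 16 * ν ^ 2 / π ^ 2 * resolventSum ν 1 * (parityCoeff ν 0 j * parityCoeff ν 0 j')
        + 16 * ν ^ 2 / π ^ 2 * resolventSum ν 0 * (parityCoeff ν 1 j * parityCoeff ν 1 j') := by
  unfold parityCoeff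
  rcases Nat.even_or_odd j with hj | hj <;> rcases Nat.even_or_odd j' with hj' | hj'
  · rw [resolventSum_congr (p := j) (q := 0) (by simpa using hj)]
    simp [Nat.even_add, hj, hj', Nat.not_odd_iff_even.mpr hj]
  · simp [Nat.even_add, Nat.odd_add, hj, hj', Nat.not_even_iff_odd.mpr hj',
      Nat.not_odd_iff_even.mpr hj]
  · simp [Nat.even_add, Nat.odd_add, hj, hj', Nat.not_even_iff_odd.mpr hj,
      Nat.not_odd_iff_even.mpr hj']
  · rw [resolventSum_congr (p := j) (q := 1) (by grind)]
    simp [Nat.even_add, Nat.odd_add, hj, hj', Nat.not_even_iff_odd.mpr hj,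
      Nat.not_even_iff_odd.mpr hj']

lemma mul_sum_sq_eq_sum_sum {ι : Type*} (c : ℝ) (s : Finset ι) (f : ι → ℝ) :
    c * (∑ j ∈ s, f j) ^ 2 = ∑ j ∈ s, ∑ j' ∈ s, c * (f j * f j') := by
  rw [pow_two, Finset.sum_mul_sum, Finset.mul_sum]
  simp_rw [Finset.mul_sum]

lemma hasSum_weighted_sum_sq {ν : ℝ} (hν : 0 < ν) {s : Finset ℕ} (hs : 0 ∉ s) (x : ℕ → ℝ) :
    HasSum (fun k : ℕ => ν ^ 2 / (ν ^ 2 + (k : ℝ) ^ 2) * (∑ j ∈ s, Emat k j * x j) ^ 2)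
      (∑ j ∈ s, ν ^ 2 / (ν ^ 2 + (j : ℝ) ^ 2) * x j ^ 2
        + 16 * ν ^ 2 / π ^ 2 * resolventSum ν 1 * (∑ j ∈ s, parityCoeff ν 0 j * x j) ^ 2
        + 16 * ν ^ 2 / π ^ 2 * resolventSum ν 0 * (∑ j ∈ s, parityCoeff ν 1 j * x j) ^ 2) := by
  have hne : ∀ j ∈ s, j ≠ 0 := fun j hj h => hs (h ▸ hj)
  have h : HasSum (fun k : ℕ => ∑ j ∈ s, ∑ j' ∈ s,
      x j * x j' * (ν ^ 2 / (ν ^ 2 + (k : ℝ) ^ 2) * (Emat k j * Emat k j'))) _ :=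
    hasSum_sum fun j hj => hasSum_sum fun j' hj' =>
      (hasSum_weighted_Emat_mul_Emat hν (hne j hj) (hne j' hj')).mul_left (x j * x j')
  refine h.of_eq (fun k => ?_) ?_
  · rw [mul_sum_sq_eq_sum_sum]
    exact Finset.sum_congr rfl fun j _ => Finset.sum_congr rfl fun j' _ => by ring
  · simp_rw [even_add_mul_eq_parityCoeff, mul_add, Finset.sum_add_distrib]
    rw [← add_assoc]
    congr 1
    · congr 1
      · refine Finset.sum_congr rfl fun j hj => ?_
        simp only [mul_ite, mul_zero, Finset.sum_ite_eq, hj, if_true]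
        ring
      · rw [mul_sum_sq_eq_sum_sum]
        exact Finset.sum_congr rfl fun j _ => Finset.sum_congr rfl fun j' _ => by ring
    · rw [mul_sum_sq_eq_sum_sum]
      exact Finset.sum_congr rfl fun j _ => Finset.sum_congr rfl fun j' _ => by ring

lemma mul_sq_sum_parityCoeff_le {ν : ℝ} (hν : 0 < ν) {p : ℕ} {s : Finset ℕ} {c : ℝ} (hc : 0 ≤ c)
    (h : c * ∑ j ∈ s, parityCoeff ν p j ^ 2 / formCoeff ν j ≤ 1) (x : ℕ → ℝ) :
    c * (∑ j ∈ s, parityCoeff ν p j * x j) ^ 2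
      ≤ ∑ j ∈ s, if Odd (p + j) then formCoeff ν j * x j ^ 2 else 0 := by
  have hw : ∀ j, 0 < formCoeff ν j := fun j => by linarith [eight_le_formCoeff hν j]
  have hnn : ∀ j, 0 ≤ if Odd (p + j) then formCoeff ν j * x j ^ 2 else 0 := fun j => by
    have := hw j
    split_ifs <;> positivity
  have hcs : (∑ j ∈ s, parityCoeff ν p j * x j) ^ 2
      ≤ (∑ j ∈ s, parityCoeff ν p j ^ 2 / formCoeff ν j)
        * ∑ j ∈ s, if Odd (p + j) then formCoeff ν j * x j ^ 2 else 0 := by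
    refine Finset.sum_sq_le_sum_mul_sum_of_sq_le_mul s (fun j _ => ?_) (fun j _ => hnn j)
      (fun j _ => ?_)
    · have := hw j
      positivity
    · have := (hw j).ne'
      unfold parityCoeff
      split_ifs
      · exact le_of_eq (by field_simp)
      · simp
  calc _ ≤ c * ((∑ j ∈ s, parityCoeff ν p j ^ 2 / formCoeff ν j)
        * ∑ j ∈ s, if Odd (p + j) then formCoeff ν j * x j ^ 2 else 0) := by gcongr
    _ = (c * ∑ j ∈ s, parityCoeff ν p j ^ 2 / formCoeff ν j)
        * ∑ j ∈ s, (if Odd (p + j) then formCoeff ν j * x j ^ 2 else 0) := by ring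
    _ ≤ 1 * _ := by
        gcongr
        exact Finset.sum_nonneg fun j _ => hnn j
    _ = _ := one_mul _

lemma weighted_sum_sq_le_of_finset {ν : ℝ} (hν : 0 < ν) {s : Finset ℕ} (hs : 0 ∉ s) (x : ℕ → ℝ)
    (t : Finset ℕ) :
    9 * ∑ k ∈ t, ν ^ 2 / (ν ^ 2 + (k : ℝ) ^ 2) * (∑ j ∈ s, Emat k j * x j) ^ 2
      ≤ ∑ j ∈ s, (max 9 ((9 / 4) / ν ^ 2) * (ν ^ 2 / (ν ^ 2 + (j : ℝ) ^ 2) * x j ^ 2)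
        + 8 * x j ^ 2) := by
  have h1 := sum_le_hasSum t (fun k _ => by positivity) (hasSum_weighted_sum_sq hν hs x)
  have hR0 := resolventSum_nonneg hν 0
  have hR1 := resolventSum_nonneg hν 1
  have h2 := mul_sq_sum_parityCoeff_le hν (by positivity) (boundary_sum_zero_le hν s) x
  have h3 := mul_sq_sum_parityCoeff_le hν (by positivity) (boundary_sum_one_le hν s) x
  have h4 : ∑ j ∈ s, (max 9 ((9 / 4) / ν ^ 2) * (ν ^ 2 / (ν ^ 2 + (j : ℝ) ^ 2) * x j ^ 2)
        + 8 * x j ^ 2) = 9 * ∑ j ∈ s, ν ^ 2 / (ν ^ 2 + (j : ℝ) ^ 2) * x j ^ 2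
      + ((∑ j ∈ s, if Odd (0 + j) then formCoeff ν j * x j ^ 2 else 0)
        + ∑ j ∈ s, if Odd (1 + j) then formCoeff ν j * x j ^ 2 else 0) := by
    rw [Finset.mul_sum, ← Finset.sum_add_distrib, ← Finset.sum_add_distrib]
    refine Finset.sum_congr rfl fun j _ => ?_
    rcases Nat.even_or_odd j with hj | hj
    · simp [hj, Nat.not_odd_iff_even.mpr hj, formCoeff]
      ring
    · simp [Nat.odd_add, hj, Nat.not_even_iff_odd.mpr hj, formCoeff]
      ring
  rw [h4]
  linarith

lemma memℓp_two_of_summable_sq {f : ℕ → ℝ} (h : Summable fun k => f k ^ 2) :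
    Memℓp (E := fun _ : ℕ => ℝ) f 2 := by
  refine memℓp_gen ?_
  simpa using h

lemma summable_sq_Emat (j : ℕ) : Summable fun k => Emat k j ^ 2 := by
  rcases eq_or_ne j 0 with rfl | hj
  · simp [Emat_zero_right]
  · simpa [sq] using (hasSum_Emat_mul_Emat hj hj).summable

/-- The columns `j ≥ 1` of `Emat`, as elements of `ℓ²`. -/
noncomputable def EmatCol (j : ℕ) : lp (fun _ : ℕ => ℝ) 2 :=
  ⟨fun k => Emat k (j + 1), memℓp_two_of_summable_sq (summable_sq_Emat (j + 1))⟩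

lemma orthonormal_EmatCol : Orthonormal ℝ EmatCol := by
  rw [orthonormal_iff_ite]
  intro i j
  refine (lp.hasSum_inner (𝕜 := ℝ) (EmatCol i) (EmatCol j)).unique ?_
  refine (hasSum_Emat_mul_Emat i.succ_ne_zero j.succ_ne_zero).of_eq (fun k => ?_) ?_
  · simp [EmatCol, mul_comm]
  · simp

lemma hasSum_Emat_mul {x : ℕ → ℝ} (hx0 : x 0 = 0) (hx : Summable fun j => x j ^ 2) :
    ∃ y : ℕ → ℝ, (∀ k, HasSum (fun j => Emat k j * x j) (y k)) ∧
      HasSum (fun k => y k ^ 2) (∑' j, x j ^ 2) := by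
  have hx' : Summable fun j => x (j + 1) ^ 2 := (summable_nat_add_iff 1).mpr hx
  let f : lp (fun _ : ℕ => ℝ) 2 := ⟨fun j => x (j + 1), memℓp_two_of_summable_sq hx'⟩
  let V := orthonormal_EmatCol.orthogonalFamily.linearIsometry
  have hnorm : ∀ g : lp (fun _ : ℕ => ℝ) 2, HasSum (fun k => g k ^ 2) (‖g‖ ^ 2) := fun g => by
    simpa using lp.hasSum_norm (p := 2) (by norm_num) g
  refine ⟨V f, fun k => ?_, ?_⟩
  · have h := orthonormal_EmatCol.orthogonalFamily.hasSum_linearIsometry f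
    have hk := h.mapL (lp.evalCLM ℝ (fun _ : ℕ => ℝ) 2 k)
    rw [← hasSum_nat_add_iff' 1]
    refine hk.of_eq (fun j => ?_) ?_
    · exact mul_comm _ _
    · rw [Finset.sum_range_one, hx0, mul_zero, sub_zero]
      rfl
  · refine (hnorm (V f)).of_eq (fun _ => rfl) ?_
    rw [V.norm_map, ← (hnorm f).tsum_eq, hx.tsum_eq_zero_add]
    simp [hx0, f]

lemma real_sine_cosine_infsup {x y : ℕ → ℝ} (hx : Summable fun j => x j ^ 2)
    (hxy : ∀ k, HasSum (fun j => Emat k j * x j) (y k))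
    (hy : HasSum (fun k => y k ^ 2) (∑' j, x j ^ 2)) {ν : ℝ} (hν : 0 < ν)
    (hS : Summable fun k : ℕ => ν ^ 2 / (ν ^ 2 + (k : ℝ) ^ 2) * y k ^ 2)
    (hH : Summable fun k : ℕ => (k : ℝ) ^ 2 / (ν ^ 2 + (k : ℝ) ^ 2) * y k ^ 2)
    (hL : Summable fun j : ℕ => ν ^ 2 / (ν ^ 2 + (j : ℝ) ^ 2) * x j ^ 2) :
    ∑' k : ℕ, ν ^ 2 / (ν ^ 2 + (k : ℝ) ^ 2) * y k ^ 2
      ≤ max 9 ((9 / 4) / ν ^ 2) * ∑' j : ℕ, ν ^ 2 / (ν ^ 2 + (j : ℝ) ^ 2) * x j ^ 2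
        + (9 - 1) * ∑' k : ℕ, (k : ℝ) ^ 2 / (ν ^ 2 + (k : ℝ) ^ 2) * y k ^ 2 := by
  have hC : 0 ≤ max 9 ((9 / 4) / ν ^ 2) := le_max_of_le_left (by norm_num)
  have hR := (hL.hasSum.mul_left (max 9 ((9 / 4) / ν ^ 2))).add (hx.hasSum.mul_left 8)
  have hfin : ∀ t : Finset ℕ, 9 * ∑ k ∈ t, ν ^ 2 / (ν ^ 2 + (k : ℝ) ^ 2) * y k ^ 2
      ≤ max 9 ((9 / 4) / ν ^ 2) * (∑' j : ℕ, ν ^ 2 / (ν ^ 2 + (j : ℝ) ^ 2) * x j ^ 2)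
        + 8 * ∑' j, x j ^ 2 := by
    intro t
    have hlim : Filter.Tendsto (fun s : Finset ℕ => 9 * ∑ k ∈ t,
        ν ^ 2 / (ν ^ 2 + (k : ℝ) ^ 2) * (∑ j ∈ s, Emat k j * x j) ^ 2) Filter.atTop
        (nhds (9 * ∑ k ∈ t, ν ^ 2 / (ν ^ 2 + (k : ℝ) ^ 2) * y k ^ 2)) :=
      (tendsto_finsetSum t fun k _ => (Filter.Tendsto.pow (hxy k) 2).const_mul _).const_mul 9
    refine le_of_tendsto hlim (Filter.Eventually.of_forall fun s => ?_)
    have herase : ∀ k, ∑ j ∈ s, Emat k j * x j = ∑ j ∈ s.erase 0, Emat k j * x j := fun k =>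
      (Finset.sum_erase s (by rw [Emat_zero_right, zero_mul])).symm
    simp_rw [herase]
    exact (weighted_sum_sq_le_of_finset hν (Finset.notMem_erase 0 s) x t).trans
      (sum_le_hasSum _ (fun j _ => by positivity) hR)
  have h1 : 9 * ∑' k : ℕ, ν ^ 2 / (ν ^ 2 + (k : ℝ) ^ 2) * y k ^ 2
      ≤ max 9 ((9 / 4) / ν ^ 2) * (∑' j : ℕ, ν ^ 2 / (ν ^ 2 + (j : ℝ) ^ 2) * x j ^ 2)
        + 8 * ∑' j, x j ^ 2 :=
    le_of_tendsto (Filter.Tendsto.const_mul 9 hS.hasSum) (Filter.Eventually.of_forall hfin)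
  have h2 : ∑' j, x j ^ 2 = ∑' k : ℕ, ν ^ 2 / (ν ^ 2 + (k : ℝ) ^ 2) * y k ^ 2
      + ∑' k : ℕ, (k : ℝ) ^ 2 / (ν ^ 2 + (k : ℝ) ^ 2) * y k ^ 2 := by
    refine hy.unique ((hS.hasSum.add hH.hasSum).of_eq (fun k => ?_) rfl)
    have : ν ^ 2 + (k : ℝ) ^ 2 ≠ 0 := by positivity
    field_simp
  linarith

lemma summable_div_mul_sq {u v z : ℕ → ℝ} (hu : ∀ k, 0 ≤ u k) (huv : ∀ k, u k ≤ v k)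
    (hz : Summable fun k => z k ^ 2) : Summable fun k => u k / v k * z k ^ 2 :=
  hz.of_nonneg_of_le
    (fun k => mul_nonneg (div_nonneg (hu k) ((hu k).trans (huv k))) (sq_nonneg _))
    (fun k => mul_le_of_le_one_left (sq_nonneg _)
      (div_le_one_of_le₀ (huv k) ((hu k).trans (huv k))))

/-- Lemma 3.2: if `a = Eb` with `b ∈ ℓ²` then for all `ν > 0`,
`∑_k ν²/(ν²+k²)|a_k|² ≤ C₁ ∑_j ν²/(ν²+j²)|b_j|² + (C₂−1) ∑_{k≥1} k²/(ν²+k²)|a_k|²`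
with `C₁ = max(9, (9/4)ν⁻²)` and `C₂ = 9`. -/
theorem sine_cosine_infsup_lemma (b : ℕ → ℂ) (hb0 : b 0 = 0)
    (hb : Summable fun j => ‖b j‖ ^ 2)
    (a : ℕ → ℂ) (ha : ∀ k, a k = ∑' j : ℕ, (Emat k j : ℂ) * b j)
    (ν : ℝ) (hν : 0 < ν) :
    ∑' k : ℕ, ν ^ 2 / (ν ^ 2 + (k : ℝ) ^ 2) * ‖a k‖ ^ 2
    ≤ max 9 ((9 / 4) / ν ^ 2) *
        ∑' j : ℕ, ν ^ 2 / (ν ^ 2 + (j : ℝ) ^ 2) * ‖b j‖ ^ 2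
      + (9 - 1) * ∑' k : ℕ, (k : ℝ) ^ 2 / (ν ^ 2 + (k : ℝ) ^ 2) * ‖a k‖ ^ 2 := by
  have hsq : ∀ z : ℂ, ‖z‖ ^ 2 = z.re ^ 2 + z.im ^ 2 := fun z => by
    rw [Complex.sq_norm, Complex.normSq_apply]
    ring
  have hbre : Summable fun j => (b j).re ^ 2 := hb.of_nonneg_of_le (fun j => sq_nonneg _)
    (fun j => by rw [hsq]; linarith [sq_nonneg (b j).im])
  have hbim : Summable fun j => (b j).im ^ 2 := hb.of_nonneg_of_le (fun j => sq_nonneg _)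
    (fun j => by rw [hsq]; linarith [sq_nonneg (b j).re])
  obtain ⟨y, hy, hy2⟩ := hasSum_Emat_mul (x := fun j => (b j).re) (by simp [hb0]) hbre
  obtain ⟨z, hz, hz2⟩ := hasSum_Emat_mul (x := fun j => (b j).im) (by simp [hb0]) hbim
  have hayz : ∀ k, a k = ⟨y k, z k⟩ := fun k => by
    rw [ha k]
    refine HasSum.tsum_eq ((Complex.hasSum_iff _ _).mpr ⟨?_, ?_⟩)
    · simpa using hy k
    · simpa using hz k
  have hν2 : 0 ≤ ν ^ 2 := sq_nonneg ν
  have hlow : ∀ {w : ℕ → ℝ}, (Summable fun k => w k ^ 2) →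
      Summable fun k : ℕ => ν ^ 2 / (ν ^ 2 + (k : ℝ) ^ 2) * w k ^ 2 := fun hw =>
    summable_div_mul_sq (fun _ => hν2) (fun k => le_add_of_nonneg_right (sq_nonneg _)) hw
  have hhigh : ∀ {w : ℕ → ℝ}, (Summable fun k => w k ^ 2) →
      Summable fun k : ℕ => (k : ℝ) ^ 2 / (ν ^ 2 + (k : ℝ) ^ 2) * w k ^ 2 := fun hw =>
    summable_div_mul_sq (fun _ => sq_nonneg _) (fun k => le_add_of_nonneg_left hν2) hw
  have hre := real_sine_cosine_infsup hbre hy hy2 hν (hlow hy2.summable) (hhigh hy2.summable)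
    (hlow hbre)
  have him := real_sine_cosine_infsup hbim hz hz2 hν (hlow hz2.summable) (hhigh hz2.summable)
    (hlow hbim)
  simp_rw [hsq, hayz, mul_add]
  rw [(hlow hy2.summable).tsum_add (hlow hz2.summable),
    (hhigh hy2.summable).tsum_add (hhigh hz2.summable), (hlow hbre).tsum_add (hlow hbim)]
  linarith
end

section
/- For every mean-zero function q ∈ L²(R) on the x-periodic rectangle R = T × (0,H) with circumference L, ‖q‖²_{L²} ≤ C₁·‖∂_x q‖²_{H⁻¹} + C₂·‖∂_y q‖²_{H⁻¹}, where C₁ = max(9, (9/16)L²/H²), C₂ = 9, and ‖f‖_{H⁻¹} = sup_{u ∈ H¹₀(R), u ≠ 0} |⟨f,u⟩|/‖∇u‖_{L²}. -/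
open MeasureTheory Set

/-- The x-periodic rectangle `R = T × (0,H)`. -/
def RectR (L H : ℝ) : Set (ℝ × ℝ) := (Set.Ioo 0 L) ×ˢ (Set.Ioo 0 H)

/-- Test functions modeling `H¹₀(R)`: `C¹`, `L`-periodic in `x`, vanishing on
the top and bottom walls. -/
def AdmRect (L H : ℝ) (u : ℝ × ℝ → ℝ) : Prop :=
  ContDiff ℝ 1 u ∧ (∀ x y, u (x + L, y) = u (x, y)) ∧
    (∀ x, u (x, 0) = 0) ∧ (∀ x, u (x, H) = 0)

/-- The squared energy (H¹ semi-)norm `‖∇u‖²_{L²(R)}`. -/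
noncomputable def energyRect (L H : ℝ) (u : ℝ × ℝ → ℝ) : ℝ :=
  ∫ p in RectR L H, (fderiv ℝ u p (1, 0)) ^ 2 + (fderiv ℝ u p (0, 1)) ^ 2

/-- A weak Poincaré inequality for functions vanishing at both ends of an interval of length `h`. -/
theorem poincare_interval {α h : ℝ} (hh : 0 < h) {w w' : ℝ → ℝ}
    (hw : ∀ y, HasDerivAt w (w' y) y) (hw' : Continuous w')
    (h0 : w α = 0) (h1 : w (α + h) = 0) :
    6 * ∫ y in α..α + h, w y ^ 2 ≤ h ^ 2 * ∫ y in α..α + h, w' y ^ 2 := by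
  have hwc : Continuous w := continuous_iff_continuousAt.2 fun y => (hw y).continuousAt
  set g : ℝ → ℝ := fun y => h ^ 2 / 3 - (y - α - h / 2) ^ 2 with hg
  have hgpos : ∀ y ∈ uIcc α (α + h), 0 < g y := by
    intro y hy
    rw [uIcc_of_le (by linarith)] at hy
    simp only [hg]
    nlinarith [mul_nonneg (sub_nonneg.2 hy.1) (sub_nonneg.2 hy.2)]
  have hgle : ∀ y, g y ≤ h ^ 2 / 3 := fun y => by
    simp only [hg]; nlinarith [sq_nonneg (y - α - h / 2)]
  have hgc : Continuous g := by fun_prop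
  set r : ℝ → ℝ := fun y => -2 * (y - α - h / 2) with hr
  set G' : ℝ → ℝ := fun y => 2 * w y * w' y * (r y / g y)
    + w y ^ 2 * ((-2 * g y - r y * r y) / g y ^ 2) with hG'
  have hder : ∀ y ∈ uIcc α (α + h), HasDerivAt (fun y => w y ^ 2 * (r y / g y)) (G' y) y := by
    intro y hy
    have hgd : HasDerivAt g (r y) y := by
      have := ((((hasDerivAt_id y).sub_const α).sub_const (h / 2)).pow 2).const_sub (h ^ 2 / 3)
      exact this.congr_deriv (by simp [hr])
    have hrd : HasDerivAt r (-2) y := by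
      have := ((((hasDerivAt_id y).sub_const α).sub_const (h / 2)).const_mul (-2))
      exact this.congr_deriv (by simp)
    have := ((hw y).pow 2).mul (hrd.div hgd (hgpos y hy).ne')
    exact this.congr_deriv (by simp [hG'])
  have hcont : ContinuousOn G' (uIcc α (α + h)) := by
    have hne : ∀ y ∈ uIcc α (α + h), g y ≠ 0 := fun y hy => (hgpos y hy).ne'
    have hrc : Continuous r := by fun_prop
    refine ContinuousOn.add ?_ ?_
    · exact ContinuousOn.mul (by fun_prop) (hrc.continuousOn.div hgc.continuousOn hne)
    · exact ContinuousOn.mul (by fun_prop)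
        (ContinuousOn.div (by fun_prop) (by fun_prop) fun y hy => pow_ne_zero 2 (hne y hy))
  have hint : ∫ y in α..α + h, G' y = 0 := by
    rw [intervalIntegral.integral_eq_sub_of_hasDerivAt hder hcont.intervalIntegrable]
    simp [h0, h1]
  have hpt : ∀ y ∈ Icc α (α + h), G' y ≤ w' y ^ 2 - 6 / h ^ 2 * w y ^ 2 := by
    intro y hy
    have hgy := hgpos y (by rwa [uIcc_of_le (by linarith)])
    have h6 : 6 / h ^ 2 ≤ 2 / g y := by
      rw [div_le_div_iff₀ (by positivity) hgy]
      linarith [hgle y]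
    have hid : w' y ^ 2 - 6 / h ^ 2 * w y ^ 2 - G' y
        = (w' y - r y / g y * w y) ^ 2 + w y ^ 2 * (2 / g y - 6 / h ^ 2) := by
      simp only [hG']
      field_simp
      ring
    have := mul_nonneg (sq_nonneg (w y)) (sub_nonneg.2 h6)
    nlinarith [sq_nonneg (w' y - r y / g y * w y)]
  have hmono : ∫ y in α..α + h, G' y ≤ ∫ y in α..α + h, (w' y ^ 2 - 6 / h ^ 2 * w y ^ 2) :=
    intervalIntegral.integral_mono_on (by linarith) hcont.intervalIntegrable
      (Continuous.intervalIntegrable (by fun_prop) _ _) hpt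
  rw [hint, intervalIntegral.integral_sub (Continuous.intervalIntegrable (by fun_prop) _ _)
    (Continuous.intervalIntegrable (by fun_prop) _ _),
    intervalIntegral.integral_const_mul] at hmono
  have hh2 : (0 : ℝ) < h ^ 2 := by positivity
  have := mul_le_mul_of_nonneg_left hmono hh2.le
  rw [mul_zero, mul_sub, ← mul_assoc, mul_div_cancel₀ _ hh2.ne'] at this
  linarith

/-- The parabola `t (1 - t)` cut off outside `[0, 1]`. -/
noncomputable def cutParabola (t : ℝ) : ℝ := max 0 (t * (1 - t))

/-- A `C¹` bump supported in `[0, 1]` with unit mass. -/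
noncomputable def cellBump (t : ℝ) : ℝ := 60 * cutParabola t ^ 2 - 140 * cutParabola t ^ 3

/-- The derivative of `cellBump`. -/
noncomputable def cellBumpDeriv (t : ℝ) : ℝ :=
  (120 * cutParabola t - 420 * cutParabola t ^ 2) * (1 - 2 * t)

theorem continuous_cutParabola : Continuous cutParabola := by
  unfold cutParabola; fun_prop

theorem continuous_cellBump : Continuous cellBump := by
  have := continuous_cutParabola
  unfold cellBump; fun_prop

theorem continuous_cellBumpDeriv : Continuous cellBumpDeriv := by
  have := continuous_cutParabola
  unfold cellBumpDeriv; fun_prop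

theorem cutParabola_of_mem {t : ℝ} (ht : t ∈ Icc (0 : ℝ) 1) : cutParabola t = t * (1 - t) :=
  max_eq_right (mul_nonneg ht.1 (by linarith [ht.2]))

theorem cutParabola_of_not_mem {t : ℝ} (ht : t ≤ 0 ∨ 1 ≤ t) : cutParabola t = 0 := by
  refine max_eq_left ?_
  rcases ht with h | h <;> nlinarith

theorem hasDerivAt_sq_max_zero (s : ℝ) :
    HasDerivAt (fun s : ℝ => max 0 s ^ 2) (2 * max 0 s) s := by
  rcases lt_trichotomy s 0 with h | rfl | h
  · rw [max_eq_left h.le]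
    refine ((hasDerivAt_const s (0 : ℝ)).congr_of_eventuallyEq ?_).congr_deriv (by simp)
    filter_upwards [gt_mem_nhds h] with x hx
    simp [max_eq_left hx.le]
  · rw [hasDerivAt_iff_isLittleO_nhds_zero]
    refine Asymptotics.IsBigO.trans_isLittleO (g := fun x : ℝ => x ^ 2) ?_ ?_
    · refine Asymptotics.IsBigO.of_bound 1 (Filter.Eventually.of_forall fun x => ?_)
      rcases le_total x 0 with h | h
      · simp [max_eq_left h]; positivity
      · simp [max_eq_right h]
    · simpa using Asymptotics.isLittleO_pow_pow (𝕜 := ℝ) (m := 1) (n := 2) (by norm_num)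
  · rw [max_eq_right h.le]
    refine ((hasDerivAt_pow 2 s).congr_of_eventuallyEq ?_).congr_deriv (by simp)
    filter_upwards [lt_mem_nhds h] with x hx
    simp [max_eq_right hx.le]

theorem hasDerivAt_cube_max_zero (s : ℝ) :
    HasDerivAt (fun s : ℝ => max 0 s ^ 3) (3 * max 0 s ^ 2) s := by
  have h := (hasDerivAt_id s).mul (hasDerivAt_sq_max_zero s)
  have key : ∀ x : ℝ, x * max 0 x = max 0 x ^ 2 := fun x => by
    rcases le_total x 0 with h | h
    · simp [max_eq_left h]
    · rw [max_eq_right h]; ring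
  refine (h.congr_of_eventuallyEq (Filter.Eventually.of_forall fun x => ?_)).congr_deriv ?_
  · have := key x
    simp only [Pi.mul_apply, id]
    linear_combination -(max 0 x) * this
  · have := key s
    simp only [id]
    linear_combination 2 * this

theorem hasDerivAt_cellBump (t : ℝ) : HasDerivAt cellBump (cellBumpDeriv t) t := by
  have hp : HasDerivAt (fun t : ℝ => t * (1 - t)) (1 - 2 * t) t := by
    have := (hasDerivAt_id t).mul ((hasDerivAt_id t).const_sub 1)
    refine this.congr_deriv ?_
    simp only [id]; ring
  have h2 := (hasDerivAt_sq_max_zero (t * (1 - t))).comp t hp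
  have h3 := (hasDerivAt_cube_max_zero (t * (1 - t))).comp t hp
  refine ((h2.const_mul 60).sub (h3.const_mul 140)).congr_deriv ?_
  unfold cellBumpDeriv cutParabola
  ring

theorem cellBump_of_not_mem {t : ℝ} (ht : t ≤ 0 ∨ 1 ≤ t) : cellBump t = 0 := by
  simp [cellBump, cutParabola_of_not_mem ht]

theorem cellBumpDeriv_of_not_mem {t : ℝ} (ht : t ≤ 0 ∨ 1 ≤ t) : cellBumpDeriv t = 0 := by
  simp [cellBumpDeriv, cutParabola_of_not_mem ht]

theorem integral_sum_range_pow (n : ℕ) (c : ℕ → ℝ) :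
    ∫ t in (0 : ℝ)..1, ∑ i ∈ Finset.range n, c i * t ^ i
      = ∑ i ∈ Finset.range n, c i / (i + 1) := by
  rw [intervalIntegral.integral_finsetSum
    fun i _ => Continuous.intervalIntegrable (by fun_prop) _ _]
  refine Finset.sum_congr rfl fun i _ => ?_
  rw [intervalIntegral.integral_const_mul, integral_pow]
  simp [div_eq_mul_inv]

theorem integral_cellBump : ∫ t in (0 : ℝ)..1, cellBump t = 1 := by
  let c : ℕ → ℝ := fun i => [0, 0, 60, -260, 480, -420, 140].getD i 0
  have h : ∫ t in (0 : ℝ)..1, cellBump t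
      = ∫ t in (0 : ℝ)..1, ∑ i ∈ Finset.range 7, c i * t ^ i := by
    refine intervalIntegral.integral_congr fun t ht => ?_
    rw [uIcc_of_le zero_le_one] at ht
    simp only [cellBump, cutParabola_of_mem ht, Finset.sum_range_succ, Finset.sum_range_zero, c]
    simp
    ring
  rw [h, integral_sum_range_pow]
  norm_num [Finset.sum_range_succ, c]

theorem integral_cellBump_sq : ∫ t in (0 : ℝ)..1, cellBump t ^ 2 = 3860 / 3003 := by
  let c : ℕ → ℝ := fun i => [0, 0, 0, 0, 3600, -31200, 125200, -300000,
    465600, -476000, 310800, -117600, 19600].getD i 0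
  have h : ∫ t in (0 : ℝ)..1, cellBump t ^ 2
      = ∫ t in (0 : ℝ)..1, ∑ i ∈ Finset.range 13, c i * t ^ i := by
    refine intervalIntegral.integral_congr fun t ht => ?_
    rw [uIcc_of_le zero_le_one] at ht
    simp only [cellBump, cutParabola_of_mem ht, Finset.sum_range_succ, Finset.sum_range_zero, c]
    simp
    ring
  rw [h, integral_sum_range_pow]
  norm_num [Finset.sum_range_succ, c]

theorem integral_cellBumpDeriv_sq : ∫ t in (0 : ℝ)..1, cellBumpDeriv t ^ 2 = 1080 / 77 := by
  let c : ℕ → ℝ := fun i => [0, 0, 14400, -187200, 1069200, -3499200,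
    7164000, -9374400, 7635600, -3528000, 705600].getD i 0
  have h : ∫ t in (0 : ℝ)..1, cellBumpDeriv t ^ 2
      = ∫ t in (0 : ℝ)..1, ∑ i ∈ Finset.range 11, c i * t ^ i := by
    refine intervalIntegral.integral_congr fun t ht => ?_
    rw [uIcc_of_le zero_le_one] at ht
    simp only [cellBumpDeriv, cutParabola_of_mem ht, Finset.sum_range_succ,
      Finset.sum_range_zero, c]
    simp
    ring
  rw [h, integral_sum_range_pow]
  norm_num [Finset.sum_range_succ, c]

theorem integral_comp_cell {α h : ℝ} (hh : h ≠ 0) (f : ℝ → ℝ) :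
    ∫ y in α..α + h, f ((y - α) / h) = h * ∫ t in (0 : ℝ)..1, f t := by
  have h1 := intervalIntegral.integral_comp_sub_right (fun y => f (y / h)) α (a := α) (b := α + h)
  have h2 := intervalIntegral.integral_comp_div (a := 0) (b := h) f hh
  simp only [sub_self, add_sub_cancel_left, zero_div, div_self hh, smul_eq_mul] at h1 h2
  rw [h1, h2]

/-- The cost estimate on one cell `[α, α + h]`: the part `k v` of the source `a` carrying its mean
is spread by the bump, the rest is the derivative of `w`. -/
theorem cell_estimate {α h k C m : ℝ} (hh : 0 < h) (hk : k ≠ 0) (hC : 9 ≤ C)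
    (hlow : 22 ≤ C * (k * h) ^ 2) (hup : (k * h) ^ 2 ≤ 16)
    {a v v' w : ℝ → ℝ} (ha : Continuous a) (hm : h * m = ∫ y in α..α + h, a y)
    (hvc : Continuous v)
    (hv : ∀ y ∈ Icc α (α + h), k * v y = m * cellBump ((y - α) / h))
    (hv' : ∀ y ∈ Icc α (α + h), k * h * v' y = m * cellBumpDeriv ((y - α) / h))
    (hw : ∀ y, HasDerivAt w (a y - k * v y) y) (h0 : w α = 0) (h1 : w (α + h) = 0) :
    (∫ y in α..α + h, (k ^ 2 * v y ^ 2 + v' y ^ 2)) / C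
      + (∫ y in α..α + h, (k ^ 2 * w y ^ 2 + (a y - k * v y) ^ 2)) / 9
      ≤ ∫ y in α..α + h, a y ^ 2 := by
  have hle : α ≤ α + h := by linarith
  have hC0 : 0 < C := by linarith
  have hwc : Continuous w := continuous_iff_continuousAt.2 fun y => (hw y).continuousAt
  have hbc := continuous_cellBump
  have hbc' := continuous_cellBumpDeriv
  have hkh : k * h ≠ 0 := mul_ne_zero hk hh.ne'
  have hkh2 : 0 < (k * h) ^ 2 := by positivity
  have e1 : ∫ y in α..α + h, (k ^ 2 * v y ^ 2 + v' y ^ 2)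
      = h * m ^ 2 * (3860 / 3003 + (1080 / 77) / (k * h) ^ 2) := by
    have : ∫ y in α..α + h, (k ^ 2 * v y ^ 2 + v' y ^ 2)
        = ∫ y in α..α + h, (m ^ 2 * cellBump ((y - α) / h) ^ 2
            + m ^ 2 / (k * h) ^ 2 * cellBumpDeriv ((y - α) / h) ^ 2) := by
      refine intervalIntegral.integral_congr fun y hy => ?_
      rw [uIcc_of_le hle] at hy
      have e : v' y = m * cellBumpDeriv ((y - α) / h) / (k * h) := by
        rw [← hv' y hy]; field_simp
      simp only [e, ← mul_pow, hv y hy, div_pow]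
      rw [mul_pow m (cellBumpDeriv _)]
      ring
    rw [this, integral_comp_cell hh.ne' fun t => m ^ 2 * cellBump t ^ 2
            + m ^ 2 / (k * h) ^ 2 * cellBumpDeriv t ^ 2,
      intervalIntegral.integral_add (Continuous.intervalIntegrable (by fun_prop) _ _)
        (Continuous.intervalIntegrable (by fun_prop) _ _),
      intervalIntegral.integral_const_mul, intervalIntegral.integral_const_mul,
      integral_cellBump_sq, integral_cellBumpDeriv_sq]
    ring
  have e2 : ∫ y in α..α + h, (k ^ 2 * w y ^ 2 + (a y - k * v y) ^ 2)
      ≤ 11 / 3 * ∫ y in α..α + h, (a y - k * v y) ^ 2 := by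
    have hp := poincare_interval hh hw (by fun_prop) h0 h1
    have hnn : 0 ≤ ∫ y in α..α + h, (a y - k * v y) ^ 2 :=
      intervalIntegral.integral_nonneg hle fun y _ => sq_nonneg _
    rw [intervalIntegral.integral_add (Continuous.intervalIntegrable (by fun_prop) _ _)
        (Continuous.intervalIntegrable (by fun_prop) _ _),
      intervalIntegral.integral_const_mul]
    have h3 := mul_le_mul_of_nonneg_left hp (sq_nonneg k)
    have h4 := mul_le_mul_of_nonneg_right hup hnn
    nlinarith
  have e3 : ∫ y in α..α + h, (a y - k * v y) ^ 2
      ≤ 27 / 11 * ((∫ y in α..α + h, a y ^ 2) - h * m ^ 2)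
        + 27 / 16 * (h * m ^ 2 * (3860 / 3003 - 1)) := by
    have hpt : ∀ y ∈ Icc α (α + h), (a y - k * v y) ^ 2 ≤
        27 / 11 * (a y ^ 2 - 2 * m * a y + m ^ 2)
        + 27 / 16 * m ^ 2 * (1 - 2 * cellBump ((y - α) / h) + cellBump ((y - α) / h) ^ 2) := by
      intro y hy
      rw [hv y hy]
      nlinarith [sq_nonneg (16 * (a y - m) - 11 * (m * (1 - cellBump ((y - α) / h))))]
    refine (intervalIntegral.integral_mono_on hle (Continuous.intervalIntegrable (by fun_prop) _ _)
      (Continuous.intervalIntegrable (by fun_prop) _ _) hpt).trans_eq ?_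
    rw [intervalIntegral.integral_add (Continuous.intervalIntegrable (by fun_prop) _ _)
        (Continuous.intervalIntegrable (by fun_prop) _ _),
      intervalIntegral.integral_const_mul, intervalIntegral.integral_const_mul,
      intervalIntegral.integral_add (Continuous.intervalIntegrable (by fun_prop) _ _)
        (Continuous.intervalIntegrable (by fun_prop) _ _),
      intervalIntegral.integral_sub (Continuous.intervalIntegrable (by fun_prop) _ _)
        (Continuous.intervalIntegrable (by fun_prop) _ _),
      integral_comp_cell hh.ne' fun t => 1 - 2 * cellBump t + cellBump t ^ 2,
      intervalIntegral.integral_add (Continuous.intervalIntegrable (by fun_prop) _ _)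
        (Continuous.intervalIntegrable (by fun_prop) _ _),
      intervalIntegral.integral_sub (Continuous.intervalIntegrable (by fun_prop) _ _)
        (Continuous.intervalIntegrable (by fun_prop) _ _),
      intervalIntegral.integral_const_mul, intervalIntegral.integral_const_mul,
      integral_cellBump_sq, integral_cellBump, ← hm]
    simp only [intervalIntegral.integral_const, smul_eq_mul]
    ring
  have e4 : h * m ^ 2 * (3860 / 3003 + (1080 / 77) / (k * h) ^ 2) / C
      ≤ h * m ^ 2 * (3860 / 3003 / 9 + (1080 / 77) / 22) := by
    rw [mul_div_assoc]
    refine mul_le_mul_of_nonneg_left ?_ (by positivity)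
    rw [add_div, div_div (1080 / 77 : ℝ), mul_comm _ C]
    gcongr
  rw [e1]
  have : 0 ≤ h * m ^ 2 := by positivity
  linarith

theorem exists_cell_count {C κ : ℝ} (hC : 9 ≤ C) (hκ : 22 ≤ C * κ ^ 2) :
    ∃ J : ℕ, 0 < J ∧ 22 ≤ C * (κ / J) ^ 2 ∧ (κ / J) ^ 2 ≤ 16 := by
  wlog h0 : 0 ≤ κ generalizing κ
  · simpa [neg_div] using this (κ := -κ) (by simpa using hκ) (by linarith)
  have hpos : 0 < κ := h0.lt_of_ne fun h => by subst h; norm_num at hκ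
  have hJ : 0 < ⌈κ / 4⌉₊ := Nat.ceil_pos.2 (by positivity)
  have hJ' : (0 : ℝ) < ⌈κ / 4⌉₊ := by exact_mod_cast hJ
  refine ⟨⌈κ / 4⌉₊, hJ, ?_, ?_⟩
  · rcases Nat.lt_or_ge 1 ⌈κ / 4⌉₊ with h1 | h1
    · have h2 : (2 : ℝ) ≤ ⌈κ / 4⌉₊ := by exact_mod_cast h1
      have h3 := Nat.ceil_lt_add_one (a := κ / 4) (by positivity)
      have h4 : 2 ≤ κ / ⌈κ / 4⌉₊ := by rw [le_div_iff₀ hJ']; linarith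
      nlinarith
    · have : ⌈κ / 4⌉₊ = 1 := by omega
      simpa [this] using hκ
  · have h3 := Nat.le_ceil (κ / 4)
    have h4 : κ / ⌈κ / 4⌉₊ ≤ 4 := by rw [div_le_iff₀ hJ']; linarith
    have h5 : 0 ≤ κ / ⌈κ / 4⌉₊ := by positivity
    nlinarith

/-- Solvability of `k v + w' = a` on `(0, H)` with `v`, `w` vanishing at both ends, with a bound
on the energies. -/
theorem exists_mode_solution {H k C : ℝ} (hH : 0 < H) (hC : 9 ≤ C) (hk : 22 ≤ C * (k * H) ^ 2)
    {a : ℝ → ℝ} (ha : Continuous a) :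
    ∃ v v' w : ℝ → ℝ, Continuous v' ∧ (∀ y, HasDerivAt v (v' y) y) ∧
      (∀ y, HasDerivAt w (a y - k * v y) y) ∧ v 0 = 0 ∧ v H = 0 ∧ w 0 = 0 ∧ w H = 0 ∧
      (∫ y in (0 : ℝ)..H, (k ^ 2 * v y ^ 2 + v' y ^ 2)) / C
        + (∫ y in (0 : ℝ)..H, (k ^ 2 * w y ^ 2 + (a y - k * v y) ^ 2)) / 9
        ≤ ∫ y in (0 : ℝ)..H, a y ^ 2 := by
  have hk0 : k ≠ 0 := fun h => by subst h; norm_num at hk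
  obtain ⟨J, hJ, hlow, hup⟩ := exists_cell_count hC hk
  have hJ0 : (0 : ℝ) < J := by exact_mod_cast hJ
  obtain ⟨h, hhdef⟩ : ∃ h, h = H / J := ⟨_, rfl⟩
  have hh : 0 < h := hhdef ▸ by positivity
  have hJh : (J : ℝ) * h = H := by rw [hhdef]; field_simp
  rw [mul_div_assoc, ← hhdef] at hlow hup
  have hbc := continuous_cellBump
  have hbc' := continuous_cellBumpDeriv
  let m : ℕ → ℝ := fun j => (∫ y in (j * h)..(j * h + h), a y) / h
  let v : ℝ → ℝ := fun y => ∑ j ∈ Finset.range J, m j / k * cellBump ((y - j * h) / h)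
  let v' : ℝ → ℝ := fun y =>
    ∑ j ∈ Finset.range J, m j / k * (cellBumpDeriv ((y - j * h) / h) * (1 / h))
  let w : ℝ → ℝ := fun y => ∫ t in (0 : ℝ)..y, (a t - k * v t)
  have hvd : ∀ y, HasDerivAt v (v' y) y := fun y => by
    refine HasDerivAt.fun_sum fun j _ => HasDerivAt.const_mul _ ?_
    exact (hasDerivAt_cellBump ((y - j * h) / h)).comp y
      (((hasDerivAt_id y).sub_const (j * h)).div_const h)
  have hvc : Continuous v := continuous_iff_continuousAt.2 fun y => (hvd y).continuousAt
  have hv'c : Continuous v' := continuous_finsetSum _ fun j _ => by fun_prop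
  have hwd : ∀ y, HasDerivAt w (a y - k * v y) y := fun y =>
    intervalIntegral.integral_hasDerivAt_right (Continuous.intervalIntegrable (by fun_prop) _ _)
      (Continuous.stronglyMeasurableAtFilter (by fun_prop) _ _)
      (Continuous.continuousAt (by fun_prop))
  have hoff : ∀ i j : ℕ, i ≠ j → ∀ y ∈ Icc (j * h) (j * h + h),
      (y - i * h) / h ≤ 0 ∨ 1 ≤ (y - i * h) / h := by
    intro i j hij y hy
    rcases lt_or_gt_of_ne hij with hlt | hlt
    · right
      have : (i : ℝ) + 1 ≤ j := by exact_mod_cast hlt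
      rw [le_div_iff₀ hh]
      nlinarith [hy.1]
    · left
      have : (j : ℝ) + 1 ≤ i := by exact_mod_cast hlt
      refine div_nonpos_of_nonpos_of_nonneg ?_ hh.le
      nlinarith [hy.2]
  have hvcell : ∀ j < J, ∀ y ∈ Icc (j * h) (j * h + h),
      k * v y = m j * cellBump ((y - j * h) / h) := by
    intro j hj y hy
    simp only [v]
    rw [Finset.sum_eq_single_of_mem j (Finset.mem_range.2 hj) fun i _ hij => by
      rw [cellBump_of_not_mem (hoff i j hij y hy), mul_zero]]
    field_simp
  have hv'cell : ∀ j < J, ∀ y ∈ Icc (j * h) (j * h + h),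
      k * h * v' y = m j * cellBumpDeriv ((y - j * h) / h) := by
    intro j hj y hy
    simp only [v']
    rw [Finset.sum_eq_single_of_mem j (Finset.mem_range.2 hj) fun i _ hij => by
      rw [cellBumpDeriv_of_not_mem (hoff i j hij y hy), zero_mul, mul_zero]]
    field_simp
  have hcast : ∀ j : ℕ, ((j + 1 : ℕ) : ℝ) * h = j * h + h := fun j => by push_cast; ring
  have hm : ∀ j, h * m j = ∫ y in (j * h)..(j * h + h), a y := fun j => by
    simp only [m]; field_simp
  have hwnode : ∀ j ≤ J, w (j * h) = 0 := by
    intro j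
    induction j with
    | zero => intro _; simp [w]
    | succ j ih =>
      intro hj
      have hwj := ih (by omega)
      have hle : (j : ℝ) * h ≤ j * h + h := by linarith
      have hz : ∫ y in (j * h)..(j * h + h), (a y - k * v y) = 0 := by
        have e : ∫ y in (j * h)..(j * h + h), k * v y
            = ∫ y in (j * h)..(j * h + h), m j * cellBump ((y - j * h) / h) :=
          intervalIntegral.integral_congr fun y hy =>
            hvcell j (by omega) y (by rwa [uIcc_of_le hle] at hy)
        rw [intervalIntegral.integral_sub (Continuous.intervalIntegrable (by fun_prop) _ _)
          (Continuous.intervalIntegrable (by fun_prop) _ _), e, ← hm j,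
          integral_comp_cell hh.ne' fun t => m j * cellBump t,
          intervalIntegral.integral_const_mul, integral_cellBump]
        ring
      have hadd := intervalIntegral.integral_add_adjacent_intervals (μ := volume)
        (f := fun t => a t - k * v t) (a := 0) (b := j * h) (c := j * h + h)
        (Continuous.intervalIntegrable (by fun_prop) _ _)
        (Continuous.intervalIntegrable (by fun_prop) _ _)
      rw [hcast]
      simp only [w] at hwj ⊢
      rw [← hadd, hwj, hz, zero_add]
  have hwc : Continuous w := continuous_iff_continuousAt.2 fun y => (hwd y).continuousAt
  have hsplit : ∀ f : ℝ → ℝ, Continuous f → ∫ y in (0 : ℝ)..H, f y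
      = ∑ j ∈ Finset.range J, ∫ y in (j * h)..(j * h + h), f y := by
    intro f hf
    have := intervalIntegral.sum_integral_adjacent_intervals (μ := volume) (f := f) (n := J)
      (a := fun j : ℕ => (j : ℝ) * h) fun j _ => hf.intervalIntegrable _ _
    simp only [hcast, hJh, Nat.cast_zero, zero_mul] at this
    exact this.symm
  have hv0 : v 0 = 0 := Finset.sum_eq_zero fun j _ => by
    rw [cellBump_of_not_mem, mul_zero]
    left
    exact div_nonpos_of_nonpos_of_nonneg (by rw [zero_sub, neg_nonpos]; positivity) hh.le
  have hvH : v H = 0 := Finset.sum_eq_zero fun j hj => by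
    rw [cellBump_of_not_mem, mul_zero]
    right
    have : (j : ℝ) + 1 ≤ J := by exact_mod_cast Finset.mem_range.1 hj
    rw [le_div_iff₀ hh, ← hJh]
    nlinarith
  refine ⟨v, v', w, hv'c, hvd, hwd, hv0, hvH, by simp [w], ?_, ?_⟩
  · simpa [hJh] using hwnode J le_rfl
  · rw [hsplit _ (by fun_prop), hsplit _ (by fun_prop), hsplit _ (by fun_prop),
      Finset.sum_div, Finset.sum_div, ← Finset.sum_add_distrib]
    refine Finset.sum_le_sum fun j hj => ?_
    have hj' := Finset.mem_range.1 hj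
    refine cell_estimate hh hk0 hC hlow hup ha (hm j) hvc (hvcell j hj') (hv'cell j hj') hwd
      (hwnode j hj'.le) ?_
    rw [← hcast]
    exact hwnode (j + 1) hj'

theorem exists_mode_solution_of_eq_zero {H : ℝ} (hH : 0 < H)
    {a : ℝ → ℝ} (ha : Continuous a) :
    ∃ c : ℝ, ∃ w : ℝ → ℝ, (∀ y, HasDerivAt w (a y - c) y) ∧ w 0 = 0 ∧ w H = 0 ∧
      ∫ y in (0 : ℝ)..H, (a y - c) ^ 2 ≤ ∫ y in (0 : ℝ)..H, a y ^ 2 := by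
  obtain ⟨c, hc⟩ : ∃ c, c = (∫ y in (0 : ℝ)..H, a y) / H := ⟨_, rfl⟩
  have hc' : ∫ y in (0 : ℝ)..H, a y = c * H := by rw [hc]; field_simp
  refine ⟨c, fun y => ∫ t in (0 : ℝ)..y, (a t - c), fun y => ?_, by simp, ?_, ?_⟩
  · exact intervalIntegral.integral_hasDerivAt_right
      (Continuous.intervalIntegrable (by fun_prop) _ _)
      (Continuous.stronglyMeasurableAtFilter (by fun_prop) _ _)
      (Continuous.continuousAt (by fun_prop))
  · simp only
    rw [intervalIntegral.integral_sub (ha.intervalIntegrable _ _)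
      (Continuous.intervalIntegrable (by fun_prop) _ _), hc']
    simp [mul_comm]
  · have : ∀ y, (a y - c) ^ 2 = a y ^ 2 - 2 * c * a y + c ^ 2 := fun y => by ring
    simp only [this]
    rw [intervalIntegral.integral_add (Continuous.intervalIntegrable (by fun_prop) _ _)
        (Continuous.intervalIntegrable (by fun_prop) _ _),
      intervalIntegral.integral_sub (Continuous.intervalIntegrable (by fun_prop) _ _)
        (Continuous.intervalIntegrable (by fun_prop) _ _),
      intervalIntegral.integral_const_mul, hc']
    simp only [intervalIntegral.integral_const, smul_eq_mul]
    nlinarith [mul_nonneg hH.le (sq_nonneg c)]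

theorem exists_real_mode_solution {H k C : ℝ} (hH : 0 < H) (hC : 9 ≤ C)
    (hk : k = 0 ∨ 22 ≤ C * (k * H) ^ 2) {a : ℝ → ℝ} (ha : Continuous a) :
    ∃ c : ℝ, ∃ v v' w w' : ℝ → ℝ, (k ≠ 0 → c = 0) ∧ Continuous v' ∧ Continuous w' ∧
      (∀ y, HasDerivAt v (v' y) y) ∧ (∀ y, HasDerivAt w (w' y) y) ∧
      (∀ y, k * v y + w' y + c = a y) ∧ v 0 = 0 ∧ v H = 0 ∧ w 0 = 0 ∧ w H = 0 ∧
      (∫ y in (0 : ℝ)..H, (k ^ 2 * v y ^ 2 + v' y ^ 2)) / C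
        + (∫ y in (0 : ℝ)..H, (k ^ 2 * w y ^ 2 + w' y ^ 2)) / 9
        ≤ ∫ y in (0 : ℝ)..H, a y ^ 2 := by
  rcases hk with rfl | hk
  · obtain ⟨c, w, hw, hw0, hwH, hle⟩ := exists_mode_solution_of_eq_zero hH ha
    refine ⟨c, 0, 0, w, fun y => a y - c, by simp, continuous_const, by fun_prop,
      fun y => hasDerivAt_const y 0, hw, fun y => by simp, rfl, rfl, hw0, hwH, ?_⟩
    have hnn : 0 ≤ ∫ y in (0 : ℝ)..H, (a y - c) ^ 2 :=
      intervalIntegral.integral_nonneg hH.le fun y _ => sq_nonneg _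
    simp
    linarith
  · obtain ⟨v, v', w, hv', hv, hw, h1, h2, h3, h4, hle⟩ := exists_mode_solution hH hC hk ha
    have hvc : Continuous v := continuous_iff_continuousAt.2 fun y => (hv y).continuousAt
    exact ⟨0, v, v', w, fun y => a y - k * v y, fun _ => rfl, hv', by fun_prop, hv, hw,
      fun y => by ring, h1, h2, h3, h4, hle⟩

/-- Complex version of the solvability of one Fourier mode of the divergence equation. -/
theorem exists_complex_mode_solution {H k C : ℝ} (hH : 0 < H) (hC : 9 ≤ C)
    (hk : k = 0 ∨ 22 ≤ C * (k * H) ^ 2) {a : ℝ → ℂ} (ha : Continuous a) :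
    ∃ c : ℂ, ∃ v v' w w' : ℝ → ℂ, (k ≠ 0 → c = 0) ∧ Continuous v' ∧ Continuous w' ∧
      (∀ y, HasDerivAt v (v' y) y) ∧ (∀ y, HasDerivAt w (w' y) y) ∧
      (∀ y, v y * (k * Complex.I) + w' y + c = a y) ∧
      v 0 = 0 ∧ v H = 0 ∧ w 0 = 0 ∧ w H = 0 ∧
      (∫ y in (0 : ℝ)..H, (‖v y * (k * Complex.I)‖ ^ 2 + ‖v' y‖ ^ 2)) / C
        + (∫ y in (0 : ℝ)..H, (‖w y * (k * Complex.I)‖ ^ 2 + ‖w' y‖ ^ 2)) / 9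
        ≤ ∫ y in (0 : ℝ)..H, ‖a y‖ ^ 2 := by
  obtain ⟨c₁, v₁, v₁', w₁, w₁', hc₁, cv₁, cw₁, dv₁, dw₁, e₁, p₁, q₁, r₁, s₁, le₁⟩ :=
    exists_real_mode_solution hH hC hk (Complex.continuous_re.comp ha)
  obtain ⟨c₂, v₂, v₂', w₂, w₂', hc₂, cv₂, cw₂, dv₂, dw₂, e₂, p₂, q₂, r₂, s₂, le₂⟩ :=
    exists_real_mode_solution hH hC hk (Complex.continuous_im.comp ha)
  have kv₁ : Continuous v₁ := continuous_iff_continuousAt.2 fun y => (dv₁ y).continuousAt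
  have kv₂ : Continuous v₂ := continuous_iff_continuousAt.2 fun y => (dv₂ y).continuousAt
  have kw₁ : Continuous w₁ := continuous_iff_continuousAt.2 fun y => (dw₁ y).continuousAt
  have kw₂ : Continuous w₂ := continuous_iff_continuousAt.2 fun y => (dw₂ y).continuousAt
  refine ⟨c₁ + c₂ * Complex.I, fun y => v₂ y - v₁ y * Complex.I,
    fun y => v₂' y - v₁' y * Complex.I, fun y => w₁ y + w₂ y * Complex.I,
    fun y => w₁' y + w₂' y * Complex.I, fun h => by simp [hc₁ h, hc₂ h], by fun_prop,
    by fun_prop, fun y => (dv₂ y).ofReal_comp.sub ((dv₁ y).ofReal_comp.mul_const _),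
    fun y => (dw₁ y).ofReal_comp.add ((dw₂ y).ofReal_comp.mul_const _), fun y => ?_,
    by simp [p₁, p₂], by simp [q₁, q₂], by simp [r₁, r₂], by simp [s₁, s₂], ?_⟩
  · have h₁ := e₁ y
    have h₂ := e₂ y
    simp only [Function.comp] at h₁ h₂
    apply Complex.ext
    · rw [← h₁]; simp; ring
    · rw [← h₂]; simp; ring
  · have i₁ : ∀ y, ‖((v₂ y : ℂ) - v₁ y * Complex.I) * (k * Complex.I)‖ ^ 2
        + ‖(v₂' y : ℂ) - v₁' y * Complex.I‖ ^ 2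
        = (k ^ 2 * v₁ y ^ 2 + v₁' y ^ 2) + (k ^ 2 * v₂ y ^ 2 + v₂' y ^ 2) := fun y => by
      simp only [Complex.sq_norm, Complex.normSq_apply]; simp; ring
    have i₂ : ∀ y, ‖((w₁ y : ℂ) + w₂ y * Complex.I) * (k * Complex.I)‖ ^ 2
        + ‖(w₁' y : ℂ) + w₂' y * Complex.I‖ ^ 2
        = (k ^ 2 * w₁ y ^ 2 + w₁' y ^ 2) + (k ^ 2 * w₂ y ^ 2 + w₂' y ^ 2) := fun y => by
      simp only [Complex.sq_norm, Complex.normSq_apply]; simp; ring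
    have i₃ : ∀ y, ‖a y‖ ^ 2 = (a y).re ^ 2 + (a y).im ^ 2 := fun y => by
      simp [Complex.sq_norm, Complex.normSq_apply]; ring
    have hadd : ∀ f g : ℝ → ℝ, Continuous f → Continuous g → ∫ y in (0 : ℝ)..H, (f y + g y)
        = (∫ y in (0 : ℝ)..H, f y) + ∫ y in (0 : ℝ)..H, g y := fun f g hf hg =>
      intervalIntegral.integral_add (hf.intervalIntegrable _ _) (hg.intervalIntegrable _ _)
    simp only [i₁, i₂, i₃]
    rw [hadd (fun y => k ^ 2 * v₁ y ^ 2 + v₁' y ^ 2) (fun y => k ^ 2 * v₂ y ^ 2 + v₂' y ^ 2)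
        (by fun_prop) (by fun_prop),
      hadd (fun y => k ^ 2 * w₁ y ^ 2 + w₁' y ^ 2) (fun y => k ^ 2 * w₂ y ^ 2 + w₂' y ^ 2)
        (by fun_prop) (by fun_prop),
      hadd (fun y => (a y).re ^ 2) (fun y => (a y).im ^ 2) (by fun_prop) (by fun_prop),
      add_div, add_div]
    simp only [Function.comp] at le₁ le₂
    linarith

theorem measurableSet_RectR (L H : ℝ) : MeasurableSet (RectR L H) :=
  measurableSet_Ioo.prod measurableSet_Ioo

theorem volume_RectR_lt_top (L H : ℝ) : volume (RectR L H) < ⊤ := by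
  rw [RectR, Measure.volume_eq_prod, Measure.prod_prod, Real.volume_Ioo, Real.volume_Ioo]
  exact ENNReal.mul_lt_top ENNReal.ofReal_lt_top ENNReal.ofReal_lt_top

/-- The `n`-th wave number on a circle of circumference `L`. -/
noncomputable def waveNumber (L : ℝ) (n : ℤ) : ℝ := 2 * Real.pi * n / L

/-- The Fourier monomial of wave number `k`. -/
noncomputable def wave (k x : ℝ) : ℂ := Complex.exp (x * (k * Complex.I))

/-- The rescaled covering map of the two-dimensional torus. -/
noncomputable def toTorus (L H : ℝ) (p : ℝ × ℝ) : UnitAddTorus (Fin 2) :=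
  ![((p.1 / L : ℝ) : UnitAddCircle), ((p.2 / H : ℝ) : UnitAddCircle)]

theorem continuous_toTorus (L H : ℝ) : Continuous (toTorus L H) := by
  refine continuous_pi fun i => ?_
  fin_cases i
  · exact (AddCircle.continuous_mk' 1).comp (continuous_fst.div_const L)
  · exact (AddCircle.continuous_mk' 1).comp (continuous_snd.div_const H)

theorem exists_measurable_lift {L H : ℝ} (hL : 0 < L) (hH : 0 < H) :
    ∃ r : UnitAddTorus (Fin 2) → ℝ × ℝ, Measurable r ∧
      ∀ p ∈ RectR L H, r (toTorus L H p) = p := by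
  refine ⟨fun t => (L * (AddCircle.measurableEquivIoc 1 0 (t 0) : ℝ),
    H * (AddCircle.measurableEquivIoc 1 0 (t 1) : ℝ)), ?_, ?_⟩
  · refine Measurable.prodMk ?_ ?_
    · exact (measurable_subtype_coe.comp
        ((AddCircle.measurableEquivIoc 1 0).measurable.comp
          (measurable_pi_apply (X := fun _ : Fin 2 => UnitAddCircle) 0))).const_mul L
    · exact (measurable_subtype_coe.comp
        ((AddCircle.measurableEquivIoc 1 0).measurable.comp
          (measurable_pi_apply (X := fun _ : Fin 2 => UnitAddCircle) 1))).const_mul H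
  · have key : ∀ M x : ℝ, 0 < M → x ∈ Ioo 0 M →
        M * (AddCircle.measurableEquivIoc 1 0 ((x / M : ℝ) : UnitAddCircle) : ℝ) = x := by
      intro M x hM hx
      have hmem : x / M ∈ Ioc (0 : ℝ) (0 + 1) :=
        ⟨div_pos hx.1 hM, by rw [zero_add, div_le_one hM]; exact hx.2.le⟩
      have : (AddCircle.measurableEquivIoc 1 0 ((x / M : ℝ) : UnitAddCircle) : ℝ) = x / M :=
        AddCircle.equivIoc_coe_of_mem hmem
      rw [this]
      field_simp
    rintro ⟨x, y⟩ ⟨hx, hy⟩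
    exact Prod.ext (key L x hL hx) (key H y hH hy)

theorem mFourier_toTorus (L H : ℝ) (n : Fin 2 → ℤ) (p : ℝ × ℝ) :
    UnitAddTorus.mFourier n (toTorus L H p)
      = wave (waveNumber H (n 1)) p.2 * wave (waveNumber L (n 0)) p.1 := by
  simp only [UnitAddTorus.mFourier, ContinuousMap.coe_mk, Fin.prod_univ_two, toTorus,
    Matrix.cons_val_zero, Matrix.cons_val_one, fourier_coe_apply, wave, waveNumber]
  rw [mul_comm]
  congr 2 <;> push_cast <;> ring

theorem continuous_wave (k : ℝ) : Continuous (wave k) := by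
  unfold wave; fun_prop

/-- Elements of the span of the torus monomials are trigonometric polynomials in `x` with
continuous coefficients in `y`. -/
theorem exists_coeff_of_mem_span (L H : ℝ) {P : C(UnitAddTorus (Fin 2), ℂ)}
    (hP : P ∈ Submodule.span ℂ (range (UnitAddTorus.mFourier (d := Fin 2)))) :
    ∃ F : Finset ℤ, ∃ a : ℤ → ℝ → ℂ, (∀ n, Continuous (a n)) ∧
      ∀ p, P (toTorus L H p) = ∑ n ∈ F, a n p.2 * wave (waveNumber L n) p.1 := by
  obtain ⟨c, rfl⟩ := (Finsupp.mem_span_range_iff_exists_finsupp).1 hP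
  refine ⟨c.support.image fun m => m 0, fun n y => ∑ m ∈ c.support with m 0 = n,
    c m * wave (waveNumber H (m 1)) y, fun n => ?_, fun p => ?_⟩
  · exact continuous_finsetSum _ fun m _ => (continuous_wave _).const_mul _
  · rw [Finsupp.sum, ContinuousMap.coe_sum, Finset.sum_apply,
      ← Finset.sum_fiberwise_of_maps_to fun m hm => Finset.mem_image_of_mem (fun m => m 0) hm]
    refine Finset.sum_congr rfl fun n _ => ?_
    rw [Finset.sum_mul]
    refine Finset.sum_congr rfl fun m hm => ?_
    rw [← (Finset.mem_filter.1 hm).2, ContinuousMap.coe_smul, Pi.smul_apply, mFourier_toTorus,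
      smul_eq_mul]
    ring

theorem exists_trigonometric_approx {L H : ℝ} (hL : 0 < L) (hH : 0 < H) {q : ℝ × ℝ → ℝ}
    (hq : MemLp q 2 (volume.restrict (RectR L H))) {ε : ℝ} (hε : 0 < ε) :
    ∃ F : Finset ℤ, ∃ a : ℤ → ℝ → ℂ, (∀ n, Continuous (a n)) ∧
      ∫ p in RectR L H, ‖(q p : ℂ) - ∑ n ∈ F, a n p.2 * wave (waveNumber L n) p.1‖ ^ 2 ≤ ε := by
  obtain ⟨r, hr, hrT⟩ := exists_measurable_lift hL hH
  set μ := volume.restrict (RectR L H) with hμ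
  have : IsFiniteMeasure μ := ⟨by simpa [hμ] using volume_RectR_lt_top L H⟩
  have hT : Measurable (toTorus L H) := (continuous_toTorus L H).measurable
  set ν := μ.map (toTorus L H) with hν
  obtain ⟨q₀, hq₀, hqq⟩ := hq.aestronglyMeasurable
  set Q : UnitAddTorus (Fin 2) → ℂ := fun t => (q₀ (r t) : ℂ) with hQ
  have hQm : StronglyMeasurable Q :=
    (Complex.measurable_ofReal.comp (hq₀.measurable.comp hr)).stronglyMeasurable
  have hQT : (fun p => Q (toTorus L H p)) =ᵐ[μ] fun p => (q p : ℂ) := by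
    filter_upwards [hqq, ae_restrict_mem (measurableSet_RectR L H)] with p hp hpR
    rw [hQ]
    simp only [hrT p hpR, hp]
  have hQL : MemLp Q 2 ν := by
    rw [memLp_map_measure_iff hQm.aestronglyMeasurable hT.aemeasurable]
    exact (memLp_congr_ae hQT).2 hq.ofReal
  have : IsFiniteMeasure ν := Measure.isFiniteMeasure_map μ _
  obtain ⟨δ, hδ, hδε⟩ : ∃ δ : ℝ, 0 < δ ∧ δ ^ 2 * ν.real univ ≤ ε / 4 := by
    have hM : 0 ≤ ν.real univ := measureReal_nonneg
    refine ⟨√(ε / (4 * (ν.real univ + 1))), by positivity, ?_⟩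
    rw [Real.sq_sqrt (by positivity), div_mul_eq_mul_div, div_le_div_iff₀ (by positivity)
      (by norm_num)]
    nlinarith
  obtain ⟨g, hg, hgL⟩ := MemLp.exists_boundedContinuous_integral_rpow_sub_le (p := 2) two_pos
    (by simpa using hQL) (ε := ε / 4) (by positivity)
  simp only [Real.rpow_two] at hg
  have hgL2 : MemLp g 2 ν := by simpa using hgL
  have hI : Integrable (fun t => 2 * ‖Q t - g t‖ ^ 2) ν :=
    ((hQL.sub hgL2).integrable_norm_pow two_ne_zero).const_mul 2
  have hmem : g.toContinuousMap ∈
      (Submodule.span ℂ (range (UnitAddTorus.mFourier (d := Fin 2)))).topologicalClosure := by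
    rw [UnitAddTorus.span_mFourier_closure_eq_top]
    trivial
  obtain ⟨P, hP, hgP⟩ := Metric.mem_closure_iff.1 hmem δ hδ
  obtain ⟨F, a, ha, hFa⟩ := exists_coeff_of_mem_span L H hP
  refine ⟨F, a, ha, ?_⟩
  calc ∫ p, ‖(q p : ℂ) - ∑ n ∈ F, a n p.2 * wave (waveNumber L n) p.1‖ ^ 2 ∂μ
      = ∫ p, ‖Q (toTorus L H p) - P (toTorus L H p)‖ ^ 2 ∂μ := by
        refine integral_congr_ae ?_
        filter_upwards [hQT] with p hp
        rw [hFa, hp]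
    _ = ∫ t, ‖Q t - P t‖ ^ 2 ∂ν :=
        (integral_map hT.aemeasurable (f := fun t => ‖Q t - P t‖ ^ 2)
          ((hQm.sub P.continuous.stronglyMeasurable).norm.pow 2).aestronglyMeasurable).symm
    _ ≤ ∫ t, (2 * ‖Q t - g t‖ ^ 2 + 2 * δ ^ 2) ∂ν := by
        refine integral_mono_of_nonneg (Filter.Eventually.of_forall fun t => by positivity)
          (hI.add (integrable_const _)) (Filter.Eventually.of_forall fun t => ?_)
        have h1 : ‖g t - P t‖ ≤ δ := by
          rw [← dist_eq_norm]
          exact (ContinuousMap.dist_apply_le_dist (f := g.toContinuousMap) (g := P) t).trans hgP.le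
        have h2 : ‖Q t - P t‖ ≤ ‖Q t - g t‖ + ‖g t - P t‖ := norm_sub_le_norm_sub_add_norm_sub _ _ _
        have h3 := norm_nonneg (g t - P t)
        have h4 := norm_nonneg (Q t - P t)
        have h5 := norm_nonneg (Q t - g t)
        simp only
        nlinarith [sq_nonneg (‖Q t - g t‖ - ‖g t - P t‖)]
    _ ≤ ε := by
        rw [integral_add hI (integrable_const _), integral_const_mul, integral_const, smul_eq_mul]
        linarith

theorem wave_zero (x : ℝ) : wave 0 x = 1 := by simp [wave]

theorem wave_mul_conj (k l x : ℝ) :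
    wave k x * (starRingEnd ℂ) (wave l x) = wave (k - l) x := by
  simp only [wave, ← Complex.exp_conj, ← Complex.exp_add, map_mul, Complex.conj_ofReal,
    Complex.conj_I]
  congr 1
  push_cast
  ring

theorem wave_waveNumber_periodic {L : ℝ} (hL : 0 < L) (n : ℤ) (x : ℝ) :
    wave (waveNumber L n) (x + L) = wave (waveNumber L n) x := by
  have hL' : (L : ℂ) ≠ 0 := by exact_mod_cast hL.ne'
  rw [wave, wave, ← Complex.exp_periodic.int_mul n (x * (waveNumber L n * Complex.I))]
  congr 1
  simp only [waveNumber]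
  push_cast
  field_simp

theorem hasDerivAt_wave (k x : ℝ) : HasDerivAt (wave k) (k * Complex.I * wave k x) x := by
  have h := ((Complex.ofRealCLM.hasDerivAt (x := x)).mul_const (k * Complex.I)).cexp
  refine h.congr_deriv ?_
  simp [wave, mul_comm]

theorem integral_wave {L : ℝ} (hL : 0 < L) {n : ℤ} (hn : n ≠ 0) :
    ∫ x in (0 : ℝ)..L, wave (waveNumber L n) x = 0 := by
  have hk : (waveNumber L n : ℂ) * Complex.I ≠ 0 := by
    refine mul_ne_zero ?_ Complex.I_ne_zero
    have : (n : ℝ) ≠ 0 := by exact_mod_cast hn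
    have := Real.pi_ne_zero
    have := hL.ne'
    rw [waveNumber]
    exact_mod_cast (by positivity)
  have hd : ∀ x ∈ uIcc 0 L, HasDerivAt (fun x => wave (waveNumber L n) x
      / (waveNumber L n * Complex.I)) (wave (waveNumber L n) x) x := fun x _ =>
    ((hasDerivAt_wave (waveNumber L n) x).div_const _).congr_deriv (mul_div_cancel_left₀ _ hk)
  rw [intervalIntegral.integral_eq_sub_of_hasDerivAt hd
    ((continuous_wave _).intervalIntegrable _ _)]
  have := wave_waveNumber_periodic hL n 0
  rw [zero_add] at this
  simp [this]

theorem integral_wave_mul_conj {L : ℝ} (hL : 0 < L) (n m : ℤ) :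
    ∫ x in (0 : ℝ)..L, wave (waveNumber L n) x * (starRingEnd ℂ) (wave (waveNumber L m) x)
      = if n = m then (L : ℂ) else 0 := by
  have h : ∀ x, wave (waveNumber L n) x * (starRingEnd ℂ) (wave (waveNumber L m) x)
      = wave (waveNumber L (n - m)) x := fun x => by
    rw [wave_mul_conj]
    congr 1
    simp only [waveNumber]
    push_cast
    ring
  simp only [h]
  split_ifs with hnm
  · subst hnm
    simp [waveNumber, wave_zero]
  · exact integral_wave hL (sub_ne_zero.2 hnm)

theorem integral_norm_sq_sum_wave {L : ℝ} (hL : 0 < L) (F : Finset ℤ) (c : ℤ → ℂ) :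
    ∫ x in (0 : ℝ)..L, ‖∑ n ∈ F, c n * wave (waveNumber L n) x‖ ^ 2
      = L * ∑ n ∈ F, ‖c n‖ ^ 2 := by
  have hw := fun n => continuous_wave (waveNumber L n)
  have hexp : ∀ x, ((‖∑ n ∈ F, c n * wave (waveNumber L n) x‖ ^ 2 : ℝ) : ℂ)
      = ∑ n ∈ F, ∑ m ∈ F, c n * (starRingEnd ℂ) (c m)
        * (wave (waveNumber L n) x * (starRingEnd ℂ) (wave (waveNumber L m) x)) := fun x => by
    rw [Complex.ofReal_pow, ← Complex.mul_conj', map_sum, Finset.sum_mul_sum]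
    refine Finset.sum_congr rfl fun n _ => Finset.sum_congr rfl fun m _ => ?_
    rw [map_mul]
    ring
  have hcc : ∀ n m, Continuous fun x => c n * (starRingEnd ℂ) (c m)
      * (wave (waveNumber L n) x * (starRingEnd ℂ) (wave (waveNumber L m) x)) := fun n m =>
    continuous_const.mul ((hw n).mul (Complex.continuous_conj.comp (hw m)))
  apply Complex.ofReal_injective
  rw [← intervalIntegral.integral_ofReal]
  simp only [hexp]
  rw [intervalIntegral.integral_finsetSum fun n _ =>
    (continuous_finsetSum F fun m _ => hcc n m).intervalIntegrable _ _]
  push_cast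
  rw [Finset.mul_sum]
  refine Finset.sum_congr rfl fun n hn => ?_
  rw [intervalIntegral.integral_finsetSum fun m _ => (hcc n m).intervalIntegrable _ _]
  simp only [intervalIntegral.integral_const_mul, integral_wave_mul_conj hL, mul_ite, mul_zero]
  rw [Finset.sum_ite_eq, if_pos hn, Complex.mul_conj']
  ring

theorem integrableOn_RectR {E : Type*} [NormedAddCommGroup E] (L H : ℝ) {f : ℝ × ℝ → E}
    (hf : Continuous f) : IntegrableOn f (RectR L H) :=
  (hf.continuousOn.integrableOn_compact (isCompact_Icc.prod isCompact_Icc)).mono_set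
    (prod_mono Ioo_subset_Icc_self Ioo_subset_Icc_self)

theorem continuous_sum_wave {L : ℝ} (F : Finset ℤ) {a : ℤ → ℝ → ℂ} (ha : ∀ n, Continuous (a n)) :
    Continuous fun p : ℝ × ℝ => ∑ n ∈ F, a n p.2 * wave (waveNumber L n) p.1 :=
  continuous_finsetSum F fun n _ =>
    ((ha n).comp continuous_snd).mul ((continuous_wave _).comp continuous_fst)

theorem integral_RectR {L H : ℝ} (hL : 0 < L) (hH : 0 < H) {f : ℝ × ℝ → ℝ} (hf : Continuous f) :
    ∫ p in RectR L H, f p = ∫ y in (0 : ℝ)..H, ∫ x in (0 : ℝ)..L, f (x, y) := by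
  have hi := integrableOn_RectR L H hf
  rw [IntegrableOn, RectR, Measure.volume_eq_prod, ← Measure.prod_restrict] at hi
  rw [RectR, Measure.volume_eq_prod, ← Measure.prod_restrict, integral_prod_symm _ hi,
    intervalIntegral.integral_of_le hH.le, integral_Ioc_eq_integral_Ioo]
  simp only [intervalIntegral.integral_of_le hL.le, integral_Ioc_eq_integral_Ioo]

/-- Parseval's identity in `x`, integrated in `y`. -/
theorem integral_RectR_norm_sq_sum {L H : ℝ} (hL : 0 < L) (hH : 0 < H) (F : Finset ℤ)
    {a : ℤ → ℝ → ℂ} (ha : ∀ n, Continuous (a n)) :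
    ∫ p in RectR L H, ‖∑ n ∈ F, a n p.2 * wave (waveNumber L n) p.1‖ ^ 2
      = L * ∑ n ∈ F, ∫ y in (0 : ℝ)..H, ‖a n y‖ ^ 2 := by
  have hc : Continuous fun p : ℝ × ℝ => ‖∑ n ∈ F, a n p.2 * wave (waveNumber L n) p.1‖ ^ 2 :=
    (continuous_sum_wave F ha).norm.pow 2
  rw [integral_RectR hL hH hc]
  simp only [integral_norm_sq_sum_wave hL F]
  have hi : ∀ n, Continuous fun y => ‖a n y‖ ^ 2 := fun n => (ha n).norm.pow 2
  rw [intervalIntegral.integral_const_mul, intervalIntegral.integral_finsetSum fun n _ =>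
    (hi n).intervalIntegrable _ _]

/-- The real part of a trigonometric polynomial in `x` with coefficients depending on `y`. -/
noncomputable def trigRe (L : ℝ) (F : Finset ℤ) (v : ℤ → ℝ → ℂ) (p : ℝ × ℝ) : ℝ :=
  (∑ n ∈ F, v n p.2 * wave (waveNumber L n) p.1).re

section trigRe

variable {L H : ℝ} {F : Finset ℤ} {v v' : ℤ → ℝ → ℂ}

theorem contDiff_trigRe (hv : ∀ n y, HasDerivAt (v n) (v' n y) y) (hv' : ∀ n, Continuous (v' n)) :
    ContDiff ℝ 1 (trigRe L F v) := by
  have h1 : ∀ n, ContDiff ℝ 1 (v n) := fun n => by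
    rw [contDiff_one_iff_deriv]
    refine ⟨fun y => (hv n y).differentiableAt, ?_⟩
    rw [funext fun y => (hv n y).deriv]
    exact hv' n
  have h2 : ∀ k, ContDiff ℝ 1 (wave k) := fun k => by
    rw [contDiff_one_iff_deriv]
    refine ⟨fun x => (hasDerivAt_wave k x).differentiableAt, ?_⟩
    rw [funext fun x => (hasDerivAt_wave k x).deriv]
    exact (continuous_wave k).const_mul _
  exact Complex.reCLM.contDiff.comp (ContDiff.sum fun n _ =>
    ((h1 n).comp contDiff_snd).mul ((h2 _).comp contDiff_fst))

theorem fderiv_trigRe_fst (hv : ∀ n y, HasDerivAt (v n) (v' n y) y)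
    (hv' : ∀ n, Continuous (v' n)) (p : ℝ × ℝ) :
    fderiv ℝ (trigRe L F v) p (1, 0)
      = trigRe L F (fun n y => v n y * (waveNumber L n * Complex.I)) p := by
  have hd := (((contDiff_trigRe (L := L) (F := F) hv hv').differentiable one_ne_zero) p).hasFDerivAt
  have h1 : HasDerivAt (fun x => trigRe L F v (x, p.2)) (fderiv ℝ (trigRe L F v) p (1, 0)) p.1 :=
    hd.comp_hasDerivAt (f := fun x => (x, p.2)) p.1
      ((hasDerivAt_id' p.1).prodMk (hasDerivAt_const p.1 p.2))
  refine h1.unique ?_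
  refine (Complex.reCLM.hasFDerivAt.comp_hasDerivAt p.1 (HasDerivAt.fun_sum fun n _ =>
    (hasDerivAt_wave (waveNumber L n) p.1).const_mul (v n p.2))).congr_deriv ?_
  simp only [trigRe, Complex.reCLM_apply, mul_assoc]

theorem fderiv_trigRe_snd (hv : ∀ n y, HasDerivAt (v n) (v' n y) y)
    (hv' : ∀ n, Continuous (v' n)) (p : ℝ × ℝ) :
    fderiv ℝ (trigRe L F v) p (0, 1) = trigRe L F v' p := by
  have hd := (((contDiff_trigRe (L := L) (F := F) hv hv').differentiable one_ne_zero) p).hasFDerivAt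
  have h1 : HasDerivAt (fun y => trigRe L F v (p.1, y)) (fderiv ℝ (trigRe L F v) p (0, 1)) p.2 :=
    hd.comp_hasDerivAt (f := fun y => (p.1, y)) p.2
      ((hasDerivAt_const p.2 p.1).prodMk (hasDerivAt_id' p.2))
  refine h1.unique ?_
  exact Complex.reCLM.hasFDerivAt.comp_hasDerivAt p.2 (HasDerivAt.fun_sum fun n _ =>
    (hv n p.2).mul_const (wave (waveNumber L n) p.1))

theorem admRect_trigRe (hL : 0 < L) (hv : ∀ n y, HasDerivAt (v n) (v' n y) y)
    (hv' : ∀ n, Continuous (v' n)) (h0 : ∀ n, v n 0 = 0) (h1 : ∀ n, v n H = 0) :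
    AdmRect L H (trigRe L F v) :=
  ⟨contDiff_trigRe hv hv', fun x y => by simp only [trigRe, wave_waveNumber_periodic hL],
    fun x => by simp [trigRe, h0], fun x => by simp [trigRe, h1]⟩

theorem continuous_trigRe (hv : ∀ n, Continuous (v n)) : Continuous (trigRe L F v) :=
  Complex.continuous_re.comp (continuous_sum_wave F hv)

theorem energyRect_trigRe_le (hL : 0 < L) (hH : 0 < H) (hv : ∀ n y, HasDerivAt (v n) (v' n y) y)
    (hv' : ∀ n, Continuous (v' n)) :
    energyRect L H (trigRe L F v) ≤ L * ∑ n ∈ F, ∫ y in (0 : ℝ)..H,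
      (‖v n y * (waveNumber L n * Complex.I)‖ ^ 2 + ‖v' n y‖ ^ 2) := by
  have hvc : ∀ n, Continuous (v n) := fun n =>
    continuous_iff_continuousAt.2 fun y => (hv n y).continuousAt
  have hvk : ∀ n, Continuous fun y => v n y * (waveNumber L n * Complex.I) := fun n =>
    (hvc n).mul_const _
  have hle : ∀ (u : ℤ → ℝ → ℂ), (∀ n, Continuous (u n)) →
      ∫ p in RectR L H, trigRe L F u p ^ 2 ≤ L * ∑ n ∈ F, ∫ y in (0 : ℝ)..H, ‖u n y‖ ^ 2 := by
    intro u hu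
    rw [← integral_RectR_norm_sq_sum hL hH F hu]
    refine integral_mono (integrableOn_RectR L H ((continuous_trigRe hu).pow 2))
      (integrableOn_RectR L H ((continuous_sum_wave F hu).norm.pow 2)) fun p => ?_
    exact sq_le_sq.2 (by rw [abs_norm]; exact Complex.abs_re_le_norm _)
  simp only [energyRect, fderiv_trigRe_fst hv hv', fderiv_trigRe_snd hv hv']
  have hi : ∀ (u : ℤ → ℝ → ℂ), (∀ n, Continuous (u n)) →
      Integrable (fun p => trigRe L F u p ^ 2) (volume.restrict (RectR L H)) := fun u hu =>
    integrableOn_RectR L H ((continuous_trigRe hu).pow 2)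
  rw [integral_add (hi _ hvk) (hi _ hv')]
  refine (add_le_add (hle _ hvk) (hle _ hv')).trans_eq ?_
  rw [← mul_add, ← Finset.sum_add_distrib]
  congr 1
  refine Finset.sum_congr rfl fun n _ => ?_
  exact (intervalIntegral.integral_add (((hvk n).norm.pow 2).intervalIntegrable _ _)
    (((hv' n).norm.pow 2).intervalIntegrable _ _)).symm

end trigRe

theorem waveNumber_bound {L H C : ℝ} (hL : 0 < L) (hH : 0 < H) (hC : (9 / 16) * L ^ 2 / H ^ 2 ≤ C)
    (n : ℤ) : waveNumber L n = 0 ∨ 22 ≤ C * (waveNumber L n * H) ^ 2 := by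
  by_cases hn : n = 0
  · left; simp [hn, waveNumber]
  right
  have h1 : (1 : ℝ) ≤ (n : ℝ) ^ 2 := by
    have : (1 : ℤ) ≤ n ^ 2 := Int.add_one_le_iff.2 (sq_pos_of_ne_zero hn)
    exact_mod_cast this
  calc (22 : ℝ) ≤ 9 / 4 * Real.pi ^ 2 * (n : ℝ) ^ 2 := by nlinarith [Real.pi_gt_d2]
    _ = (9 / 16) * L ^ 2 / H ^ 2 * (waveNumber L n * H) ^ 2 := by
      rw [waveNumber]; field_simp; ring
    _ ≤ C * (waveNumber L n * H) ^ 2 := by gcongr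

theorem two_mul_mul_sqrt_le {C E N : ℝ} (hC : 0 < C) (hE : 0 ≤ E) :
    2 * (N * √E) ≤ C * N ^ 2 + E / C := by
  have h := sq_nonneg (C * N - √E)
  have hs := Real.sq_sqrt hE
  have : C * N ^ 2 + E / C - 2 * (N * √E) = (C * N - √E) ^ 2 / C := by
    field_simp
    linear_combination -hs
  have := div_nonneg h hC.le
  linarith

theorem energyRect_nonneg (L H : ℝ) (u : ℝ × ℝ → ℝ) : 0 ≤ energyRect L H u :=
  integral_nonneg fun _ => by positivity

/-- Testing `q` against a trigonometric polynomial, by solving the divergence equation. -/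
theorem two_mul_integral_mul_trigRe_le {L H C : ℝ} (hL : 0 < L) (hH : 0 < H) (hC9 : 9 ≤ C)
    (hC : (9 / 16) * L ^ 2 / H ^ 2 ≤ C) {q : ℝ × ℝ → ℝ}
    (hq : MemLp q 2 (volume.restrict (RectR L H)))
    (hmean : ∫ p in RectR L H, q p = 0) {N₁ N₂ : ℝ}
    (hN₁ : ∀ u : ℝ × ℝ → ℝ, AdmRect L H u →
      |∫ p in RectR L H, q p * (fderiv ℝ u p (1, 0))| ≤ N₁ * √(energyRect L H u))
    (hN₂ : ∀ u : ℝ × ℝ → ℝ, AdmRect L H u →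
      |∫ p in RectR L H, q p * (fderiv ℝ u p (0, 1))| ≤ N₂ * √(energyRect L H u))
    (F : Finset ℤ) {a : ℤ → ℝ → ℂ} (ha : ∀ n, Continuous (a n)) :
    2 * ∫ p in RectR L H, q p * trigRe L F a p ≤ C * N₁ ^ 2 + 9 * N₂ ^ 2
      + ∫ p in RectR L H, ‖∑ n ∈ F, a n p.2 * wave (waveNumber L n) p.1‖ ^ 2 := by
  have hC0 : 0 < C := by linarith
  choose c v v' w w' hc hv'c hw'c hv hw heq hv0 hvH hw0 hwH hcost using fun n =>
    exists_complex_mode_solution hH hC9 (waveNumber_bound hL hH hC n) (ha n)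
  have hsplit : ∀ p, q p * trigRe L F a p
      = q p * fderiv ℝ (trigRe L F v) p (1, 0) + q p * fderiv ℝ (trigRe L F w) p (0, 1)
        + q p * (∑ n ∈ F, c n).re := by
    intro p
    rw [fderiv_trigRe_fst hv hv'c, fderiv_trigRe_snd hw hw'c, ← mul_add, ← mul_add]
    congr 1
    simp only [trigRe]
    rw [← Complex.add_re, ← Complex.add_re, ← Finset.sum_add_distrib, ← Finset.sum_add_distrib]
    congr 1
    refine Finset.sum_congr rfl fun n _ => ?_
    have hcn : c n * wave (waveNumber L n) p.1 = c n := by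
      by_cases h : waveNumber L n = 0
      · rw [h, wave_zero, mul_one]
      · rw [hc n h, zero_mul]
    rw [← heq n p.2]
    linear_combination hcn
  have hint : ∀ f : ℝ × ℝ → ℝ, Continuous f →
      Integrable (fun p => q p * f p) (volume.restrict (RectR L H)) := fun f hf =>
    hq.integrable_mul ((memLp_two_iff_integrable_sq
      hf.aestronglyMeasurable).2 (integrableOn_RectR L H (hf.pow 2)))
  have hvc : ∀ n, Continuous (v n) := fun n =>
    continuous_iff_continuousAt.2 fun y => (hv n y).continuousAt
  have i₁ : Integrable (fun p => q p * fderiv ℝ (trigRe L F v) p (1, 0))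
      (volume.restrict (RectR L H)) := by
    simp only [fderiv_trigRe_fst hv hv'c]
    exact hint _ (continuous_trigRe fun n => (hvc n).mul_const _)
  have i₂ : Integrable (fun p => q p * fderiv ℝ (trigRe L F w) p (0, 1))
      (volume.restrict (RectR L H)) := by
    simp only [fderiv_trigRe_snd hw hw'c]
    exact hint _ (continuous_trigRe hw'c)
  simp only [hsplit]
  have i₁₂ : Integrable (fun p => q p * fderiv ℝ (trigRe L F v) p (1, 0)
      + q p * fderiv ℝ (trigRe L F w) p (0, 1)) (volume.restrict (RectR L H)) := i₁.add i₂
  rw [integral_add i₁₂ (hint _ continuous_const), integral_add i₁ i₂,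
    integral_mul_const, hmean, zero_mul, add_zero, integral_RectR_norm_sq_sum hL hH F ha]
  have b₁ := (le_abs_self _).trans (hN₁ _ (admRect_trigRe (F := F) hL hv hv'c hv0 hvH))
  have b₂ := (le_abs_self _).trans (hN₂ _ (admRect_trigRe (F := F) hL hw hw'c hw0 hwH))
  have y₁ := two_mul_mul_sqrt_le (N := N₁) hC0 (energyRect_nonneg L H (trigRe L F v))
  have y₂ := two_mul_mul_sqrt_le (N := N₂) (by norm_num : (0 : ℝ) < 9)
    (energyRect_nonneg L H (trigRe L F w))
  have e₁ := div_le_div_of_nonneg_right (energyRect_trigRe_le (F := F) hL hH hv hv'c) hC0.le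
  have e₂ := div_le_div_of_nonneg_right (energyRect_trigRe_le (F := F) hL hH hw hw'c)
    (by norm_num : (0 : ℝ) ≤ 9)
  have hsum := mul_le_mul_of_nonneg_left (Finset.sum_le_sum fun n (_ : n ∈ F) => hcost n) hL.le
  rw [Finset.sum_add_distrib, ← Finset.sum_div, ← Finset.sum_div, mul_add, ← mul_div_assoc,
    ← mul_div_assoc] at hsum
  linarith

/-- Theorem 3.1: for every mean-zero `q ∈ L²(R)`,
`‖q‖₀² ≤ C₁ ‖∂ₓq‖₋₁² + C₂ ‖∂_y q‖₋₁²` with `C₁ = max(9, (9/16)L²/H²)`,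
`C₂ = 9`.  The dual norms are encoded by the numbers `N₁, N₂` bounding the
distributional pairings `⟨∂ₓq, u⟩ = −∫ q ∂ₓu`, `⟨∂_y q, u⟩ = −∫ q ∂_y u`
against the energy norm of all test functions `u ∈ H¹₀(R)`. -/
theorem infsup_rectangle (L H : ℝ) (hL : 0 < L) (hH : 0 < H)
    (q : ℝ × ℝ → ℝ)
    (hq2 : MeasureTheory.IntegrableOn (fun p => (q p) ^ 2) (RectR L H))
    (hq1 : MeasureTheory.IntegrableOn q (RectR L H))
    (hmean : ∫ p in RectR L H, q p = 0)
    (N₁ N₂ : ℝ)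
    (hN₁ : ∀ u : ℝ × ℝ → ℝ, AdmRect L H u →
      |∫ p in RectR L H, q p * (fderiv ℝ u p (1, 0))|
        ≤ N₁ * Real.sqrt (energyRect L H u))
    (hN₂ : ∀ u : ℝ × ℝ → ℝ, AdmRect L H u →
      |∫ p in RectR L H, q p * (fderiv ℝ u p (0, 1))|
        ≤ N₂ * Real.sqrt (energyRect L H u)) :
    ∫ p in RectR L H, (q p) ^ 2
      ≤ max 9 ((9 / 16) * L ^ 2 / H ^ 2) * N₁ ^ 2 + 9 * N₂ ^ 2 := by
  have hC9 : (9 : ℝ) ≤ max 9 ((9 / 16) * L ^ 2 / H ^ 2) := le_max_left _ _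
  have hC : (9 / 16) * L ^ 2 / H ^ 2 ≤ max 9 ((9 / 16) * L ^ 2 / H ^ 2) := le_max_right _ _
  have hq : MemLp q 2 (volume.restrict (RectR L H)) :=
    (memLp_two_iff_integrable_sq hq1.aestronglyMeasurable).2 hq2
  refine le_of_forall_pos_le_add fun ε hε => ?_
  obtain ⟨F, a, ha, happrox⟩ := exists_trigonometric_approx hL hH hq hε
  have htest := two_mul_integral_mul_trigRe_le hL hH hC9 hC hq hmean hN₁ hN₂ F ha
  have hexp : ∀ p : ℝ × ℝ, ‖(q p : ℂ) - ∑ n ∈ F, a n p.2 * wave (waveNumber L n) p.1‖ ^ 2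
      = q p ^ 2 - 2 * (q p * trigRe L F a p)
        + ‖∑ n ∈ F, a n p.2 * wave (waveNumber L n) p.1‖ ^ 2 := fun p => by
    simp only [trigRe, Complex.sq_norm, Complex.normSq_apply, Complex.sub_re, Complex.sub_im,
      Complex.ofReal_re, Complex.ofReal_im]
    ring
  have i₁ : Integrable (fun p => 2 * (q p * trigRe L F a p)) (volume.restrict (RectR L H)) := by
    have hc : Continuous (trigRe L F a) := continuous_trigRe ha
    exact (hq.integrable_mul ((memLp_two_iff_integrable_sq
      hc.aestronglyMeasurable).2 (integrableOn_RectR L H (hc.pow 2)))).const_mul 2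
  simp only [hexp] at happrox
  have i₂ : Integrable (fun p : ℝ × ℝ => ‖∑ n ∈ F, a n p.2 * wave (waveNumber L n) p.1‖ ^ 2)
      (volume.restrict (RectR L H)) :=
    integrableOn_RectR L H ((continuous_sum_wave F ha).norm.pow 2)
  have i₁₂ : Integrable (fun p => q p ^ 2 - 2 * (q p * trigRe L F a p))
      (volume.restrict (RectR L H)) := hq2.sub i₁
  rw [integral_add i₁₂ i₂, integral_sub hq2 i₁, integral_const_mul] at happrox
  linarith
end
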